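/- arXiv:2411.02962 — 3 statements merged into one kernel-verified Lean document; each statement's English description precedes it below -/
import Mathlib

section
/- Brown–Halmos theorem for the Dirichlet space: let T be a bounded operator on H satisfying B∘T∘S = T. Then there exists a unique sequence c : ℤ → ℂ such that ⟨T e_n, e_m⟩ = m·c(m−n) for all m, n ≥ 1; moreover this c satisfies: (i) for every z ∈ 𝔻 the series defining g(z) := Σ_{k≥1} c(k) z^k and φ(z) := g(z) + Σ_{k≥0} c(−k)·conj(z)^k converge absolutely, and φ is bounded on 𝔻 with sup_{z∈𝔻} |φ(z)| ≤ ‖T‖; and (ii) there exists C > 0 such that ∫_𝔻 |f|²·|g′|² dA ≤ C·∫_𝔻 |f′|² dA for every holomorphic f on 𝔻 with f(0) = 0 and ∫_𝔻 |f′|² dA < ∞ (so |∂φ/∂z|² dA is a Carleson measure for 𝒟₀, i.e. φ ∈ 𝒯(𝒟₀) and T is the Toeplitz operator T_φ). -/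
open MeasureTheory Metric
open scoped ENNReal ComplexConjugate

local notation "⟪" x ", " y "⟫" => @inner ℂ _ _ x y

/-- The normalized area measure `dA = π⁻¹ · (Lebesgue measure)` on `ℂ`. -/
noncomputable def dA : Measure ℂ := (ENNReal.ofReal (Real.pi)⁻¹) • (volume : Measure ℂ)

/-- The bound on shifted weighted Toeplitz forms. -/
def WB (c : ℤ → ℂ) (t : ℝ) : Prop := ∀ (M N : ℕ) (a b : ℕ → ℂ),
  ‖∑ i ∈ Finset.range N, ∑ j ∈ Finset.range N,
      ((i : ℂ) + M + 1) * c ((i : ℤ) - j) * a j * conj (b i)‖ ≤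
    t * (√(∑ i ∈ Finset.range N, ((i : ℝ) + M + 1) * ‖a i‖ ^ 2) *
      √(∑ i ∈ Finset.range N, ((i : ℝ) + M + 1) * ‖b i‖ ^ 2))

section hilbert
variable {H : Type*} [NormedAddCommGroup H] [InnerProductSpace ℂ H]

theorem toep_coef 
    (e : ℕ → H)
    (horth : ∀ m n : ℕ, 1 ≤ m → 1 ≤ n → ⟪e m, e n⟫ = if m = n then (m : ℂ) else 0)
    (hdense : Dense (Submodule.span ℂ (e '' {n : ℕ | 1 ≤ n}) : Set H))
    (S B : H →L[ℂ] H)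
    (hS : ∀ n : ℕ, 1 ≤ n → S (e n) = e (n + 1))
    (hB1 : B (e 1) = 0)
    (hB : ∀ n : ℕ, 1 ≤ n → B (e (n + 1)) = e n)
    (T : H →L[ℂ] H)
    (hT : B ∘L (T ∘L S) = T) :
    ∃ c : ℤ → ℂ, (∀ m n : ℕ, 1 ≤ m → 1 ≤ n → ⟪e m, T (e n)⟫ = (m : ℂ) * c ((m : ℤ) - n)) := by
  have hBadj : ∀ m : ℕ, 1 ≤ m → ∀ x, ((m : ℂ) + 1) * ⟪e m, B x⟫ = m * ⟪e (m+1), x⟫ := by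
    intro m hm x
    have : (((m : ℂ) + 1) • ((innerSL ℂ (e m)) ∘L B)) = (m : ℂ) • innerSL ℂ (e (m+1)) := by
      refine ContinuousLinearMap.ext_on hdense ?_
      rintro _ ⟨n, hn, rfl⟩
      simp only [Set.mem_ofPred_eq] at hn
      obtain ⟨k, rfl⟩ : ∃ k, n = k + 1 := ⟨n - 1, by omega⟩
      simp only [smul_apply, ContinuousLinearMap.comp_apply, innerSL_apply_apply, smul_eq_mul]
      rw [horth (m+1) (k+1) (by omega) hn]
      rcases Nat.eq_zero_or_pos k with rfl | hk
      · rw [hB1, inner_zero_right, if_neg (by omega)]; simp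
      · rw [hB k hk, horth m k hm hk]
        by_cases h : m = k
        · subst h; simp; ring
        · simp [h]
    simpa using congrArg (fun L => L x) this
  have step : ∀ m n : ℕ, ⟪e (m+2), T (e (n+2))⟫ / ((m : ℂ) + 2) = ⟪e (m+1), T (e (n+1))⟫ / ((m:ℂ)+1) := by
    intro m n
    have h1 := hBadj (m+1) (by omega) (T (e (n+2)))
    have h2 : B (T (e (n+2))) = T (e (n+1)) := by
      have := congrArg (fun L => L (e (n+1))) hT
      simpa [hS (n+1) (by omega)] using this
    rw [h2] at h1
    push_cast at h1
    have p1 : (m : ℂ) + 1 ≠ 0 := by exact_mod_cast Nat.succ_ne_zero m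
    have p2 : (m : ℂ) + 2 ≠ 0 := by exact_mod_cast Nat.succ_ne_zero (m+1)
    rw [div_eq_div_iff p2 p1]
    linear_combination -h1
  have step' : ∀ k m n : ℕ, ⟪e (m+k+1), T (e (n+k+1))⟫ / ((m : ℂ) + k + 1) = ⟪e (m+1), T (e (n+1))⟫ / ((m:ℂ)+1) := by
    intro k
    induction k with
    | zero => intro m n; simp
    | succ k ih => 
      intro m n
      rw [← ih m n]
      have := step (m+k) (n+k)
      push_cast at this ⊢
      rw [← this]
      congr 1; ring
  refine ⟨fun k => ⟪e (k.toNat + 1), T (e ((-k).toNat + 1))⟫ / ((k.toNat : ℂ) + 1), ?_⟩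
  intro m n hm hn
  have p1 : (m : ℂ) ≠ 0 := by exact_mod_cast (by omega : m ≠ 0)
  rw [mul_comm, ← div_eq_iff p1]
  have h := step' (min m n - 1) ((m:ℤ) - n).toNat (-((m:ℤ) - n)).toNat
  have e1 : ((m:ℤ) - n).toNat + (min m n - 1) + 1 = m := by omega
  have e2 : (-((m:ℤ) - n)).toNat + (min m n - 1) + 1 = n := by omega
  have e3 : ((((m:ℤ) - n).toNat : ℂ) + (min m n - 1 : ℕ) + 1) = m := by exact_mod_cast e1
  rw [e1, e2, e3] at h
  exact h

theorem norm_comb (e : ℕ → H)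
    (horth : ∀ m n : ℕ, 1 ≤ m → 1 ≤ n → ⟪e m, e n⟫ = if m = n then (m : ℂ) else 0)
    (M N : ℕ) (a : ℕ → ℂ) :
    ‖∑ i ∈ Finset.range N, a i • e (i + M + 1)‖ = √(∑ i ∈ Finset.range N, ((i : ℝ) + M + 1) * ‖a i‖ ^ 2) := by
  rw [@norm_eq_sqrt_re_inner ℂ]
  congr 1
  have : ⟪∑ i ∈ Finset.range N, a i • e (i + M + 1), ∑ i ∈ Finset.range N, a i • e (i + M + 1)⟫
    = ((∑ i ∈ Finset.range N, ((i : ℝ) + M + 1) * ‖a i‖ ^ 2 : ℝ) : ℂ) := by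
    rw [sum_inner]
    push_cast
    refine Finset.sum_congr rfl fun i hi => ?_
    rw [inner_sum, Finset.sum_eq_single i]
    · rw [inner_smul_left, inner_smul_right, horth _ _ (by omega) (by omega), if_pos rfl]
      push_cast
      rw [← Complex.conj_mul' (a i)]; ring
    · intro j _ hj
      rw [inner_smul_left, inner_smul_right, horth _ _ (by omega) (by omega), if_neg (by omega)]
      simp
    · intro h; exact absurd hi h
  rw [this]
  exact Complex.ofReal_re _

theorem toep_WB (e : ℕ → H)
    (horth : ∀ m n : ℕ, 1 ≤ m → 1 ≤ n → ⟪e m, e n⟫ = if m = n then (m : ℂ) else 0)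
    (T : H →L[ℂ] H) (c : ℤ → ℂ)
    (hc : ∀ m n : ℕ, 1 ≤ m → 1 ≤ n → ⟪e m, T (e n)⟫ = (m : ℂ) * c ((m : ℤ) - n)) :
    WB c ‖T‖ := by
  intro M N a b
  rw [← norm_comb e horth, ← norm_comb e horth]
  have : ∑ i ∈ Finset.range N, ∑ j ∈ Finset.range N,
      ((i : ℂ) + M + 1) * c ((i : ℤ) - j) * a j * conj (b i) = 
      ⟪∑ i ∈ Finset.range N, b i • e (i + M + 1), T (∑ i ∈ Finset.range N, a i • e (i + M + 1))⟫ := by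
    rw [sum_inner]
    refine Finset.sum_congr rfl fun i hi => ?_
    rw [map_sum, inner_sum]
    refine Finset.sum_congr rfl fun j hj => ?_
    rw [map_smul, inner_smul_left, inner_smul_right, hc _ _ (by omega) (by omega)]
    push_cast
    rw [show (i : ℤ) + M + 1 - (j + M + 1) = i - j by ring]
    ring
  rw [this]
  refine (norm_inner_le_norm _ _).trans ?_
  have := T.le_opNorm (∑ i ∈ Finset.range N, a i • e (i + M + 1))
  nlinarith [norm_nonneg (∑ i ∈ Finset.range N, b i • e (i + M + 1))]
end hilbert

section discrete
variable {c : ℤ → ℂ} {t : ℝ}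

theorem WB.H2 (h : WB c t) (N : ℕ) (a b : ℕ → ℂ) :
  ‖∑ i ∈ Finset.range N, ∑ j ∈ Finset.range N, c ((i : ℤ) - j) * a j * conj (b i)‖ ≤
    t * (√(∑ i ∈ Finset.range N, ‖a i‖ ^ 2) * √(∑ i ∈ Finset.range N, ‖b i‖ ^ 2)) := by
  have key : ∀ M : ℕ, ‖∑ i ∈ Finset.range N, ∑ j ∈ Finset.range N,
      ((i : ℂ) * ((1 / ((M:ℝ) + 1) : ℝ) : ℂ) + 1) * c ((i : ℤ) - j) * a j * conj (b i)‖ ≤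
    t * (√(∑ i ∈ Finset.range N, ((i : ℝ) * (1 / ((M:ℝ) + 1)) + 1) * ‖a i‖ ^ 2) *
      √(∑ i ∈ Finset.range N, ((i : ℝ) * (1 / ((M:ℝ) + 1)) + 1) * ‖b i‖ ^ 2)) := by
    intro M
    have hM : (0:ℝ) < (M:ℝ) + 1 := by positivity
    have hMc : (M:ℂ) + 1 ≠ 0 := by exact_mod_cast Nat.succ_ne_zero M
    have h1 := h M N a b
    have e1 : ∀ a : ℕ → ℂ, ∑ i ∈ Finset.range N, ((i : ℝ) + M + 1) * ‖a i‖ ^ 2 = 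
       ((M:ℝ) + 1) * ∑ i ∈ Finset.range N, ((i : ℝ) * (1 / ((M:ℝ) + 1)) + 1) * ‖a i‖ ^ 2 := by
      intro a
      rw [Finset.mul_sum]
      refine Finset.sum_congr rfl fun i hi => ?_
      field_simp; ring
    have e2 : ∑ i ∈ Finset.range N, ∑ j ∈ Finset.range N,
      ((i : ℂ) + M + 1) * c ((i : ℤ) - j) * a j * conj (b i) = ((M:ℂ) + 1) *
       ∑ i ∈ Finset.range N, ∑ j ∈ Finset.range N,
      ((i : ℂ) * ((1 / ((M:ℝ) + 1) : ℝ) : ℂ) + 1) * c ((i : ℤ) - j) * a j * conj (b i) := by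
      rw [Finset.mul_sum]
      refine Finset.sum_congr rfl fun i hi => ?_
      rw [Finset.mul_sum]
      refine Finset.sum_congr rfl fun j hj => ?_
      push_cast
      field_simp; ring
    have e3 : ‖(M:ℂ) + 1‖ = M + 1 := by
      rw [← Nat.cast_succ, Complex.norm_natCast]; push_cast; rfl
    rw [e1, e1, e2, norm_mul, e3, Real.sqrt_mul hM.le, Real.sqrt_mul hM.le] at h1
    refine le_of_mul_le_mul_left (h1.trans (le_of_eq ?_)) hM
    have := Real.mul_self_sqrt hM.le
    linear_combination (t * (√(∑ i ∈ Finset.range N, ((i : ℝ) * (1 / ((M:ℝ) + 1)) + 1) * ‖a i‖ ^ 2) *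
      √(∑ i ∈ Finset.range N, ((i : ℝ) * (1 / ((M:ℝ) + 1)) + 1) * ‖b i‖ ^ 2))) * this
  have lim : Filter.Tendsto (fun M : ℕ => 1 / ((M:ℝ) + 1)) Filter.atTop (nhds 0) :=
    tendsto_one_div_add_atTop_nhds_zero_nat
  let P : ℝ → ℝ := fun x => ‖∑ i ∈ Finset.range N, ∑ j ∈ Finset.range N,
      ((i : ℂ) * (x : ℂ) + 1) * c ((i : ℤ) - j) * a j * conj (b i)‖
  let Q : ℝ → ℝ := fun x => t * (√(∑ i ∈ Finset.range N, ((i : ℝ) * x + 1) * ‖a i‖ ^ 2) *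
      √(∑ i ∈ Finset.range N, ((i : ℝ) * x + 1) * ‖b i‖ ^ 2))
  have hP : Continuous P := by fun_prop
  have hQ : Continuous Q := by fun_prop
  have := le_of_tendsto_of_tendsto' ((hP.tendsto 0).comp lim) ((hQ.tendsto 0).comp lim) key
  simpa [P, Q] using this

theorem WB.minBound (h : WB c t) (ht : 0 ≤ t) (N : ℕ) (a b : ℕ → ℂ) :
  ‖∑ i ∈ Finset.range N, ∑ j ∈ Finset.range N, ((min i j : ℕ) + 1 : ℂ) * c ((i : ℤ) - j) * a j * conj (b i)‖ ≤
    t * (√(∑ i ∈ Finset.range N, ((i:ℝ) + 1) * ‖a i‖ ^ 2) * √(∑ i ∈ Finset.range N, ((i:ℝ) + 1) * ‖b i‖ ^ 2)) := by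
  let tr : ℕ → (ℕ → ℂ) → ℕ → ℂ := fun k a j => if k ≤ j then a j else 0
  have cnt : ∀ i < N, ((Finset.range N).filter (fun k => k ≤ i)).card = i + 1 := by
    intro i hi
    rw [show (Finset.range N).filter (fun k => k ≤ i) = Finset.range (i+1) by ext k; simp; omega]
    simp
  have e1 : ∑ i ∈ Finset.range N, ∑ j ∈ Finset.range N, ((min i j : ℕ) + 1 : ℂ) * c ((i : ℤ) - j) * a j * conj (b i)
    = ∑ k ∈ Finset.range N, ∑ i ∈ Finset.range N, ∑ j ∈ Finset.range N, c ((i : ℤ) - j) * tr k a j * conj (tr k b i) := by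
    conv_rhs => rw [Finset.sum_comm]
    refine Finset.sum_congr rfl fun i hi => ?_
    conv_rhs => rw [Finset.sum_comm]
    refine Finset.sum_congr rfl fun j hj => ?_
    rw [Finset.mem_range] at hi hj
    have : ∀ k, c ((i : ℤ) - j) * tr k a j * conj (tr k b i) = 
       if k ≤ min i j then c ((i : ℤ) - j) * a j * conj (b i) else 0 := by
      intro k
      by_cases h1 : k ≤ i <;> by_cases h2 : k ≤ j <;> simp [tr, h1, h2]
    simp_rw [this]
    rw [← Finset.sum_filter, Finset.sum_const, cnt _ (by omega), nsmul_eq_mul]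
    push_cast; ring
  have e2 : ∀ a : ℕ → ℂ, ∑ k ∈ Finset.range N, ∑ i ∈ Finset.range N, ‖tr k a i‖ ^ 2 = ∑ i ∈ Finset.range N, ((i:ℝ) + 1) * ‖a i‖ ^ 2 := by
    intro a
    rw [Finset.sum_comm]
    refine Finset.sum_congr rfl fun i hi => ?_
    rw [Finset.mem_range] at hi
    have : ∀ k, ‖tr k a i‖ ^ 2 = if k ≤ i then ‖a i‖ ^ 2 else 0 := by
      intro k; by_cases h1 : k ≤ i <;> simp [tr, h1]
    simp_rw [this]
    rw [← Finset.sum_filter, Finset.sum_const, cnt _ (by omega), nsmul_eq_mul]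
    push_cast; ring
  rw [e1]
  refine (norm_sum_le _ _).trans ((Finset.sum_le_sum fun k _ => h.H2 N (tr k a) (tr k b)).trans ?_)
  rw [← Finset.mul_sum, ← e2, ← e2]
  refine mul_le_mul_of_nonneg_left ?_ ht
  exact Real.sum_sqrt_mul_sqrt_le _ (fun k => Finset.sum_nonneg fun i _ => by positivity) (fun k => Finset.sum_nonneg fun i _ => by positivity)

theorem WB.diff (h : WB c t) (ht : 0 ≤ t) (N : ℕ) (a b : ℕ → ℂ) :
  ‖∑ i ∈ Finset.range N, ∑ j ∈ Finset.range N, ((i - j : ℕ) : ℂ) * c ((i : ℤ) - j) * a j * conj (b i)‖ ≤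
    2 * t * (√(∑ i ∈ Finset.range N, ((i:ℝ) + 1) * ‖a i‖ ^ 2) * √(∑ i ∈ Finset.range N, ((i:ℝ) + 1) * ‖b i‖ ^ 2)) := by
  have h1 := h 0 N a b
  have h2 := h.minBound ht N a b
  simp only [Nat.cast_zero, add_zero] at h1
  have : ∑ i ∈ Finset.range N, ∑ j ∈ Finset.range N, ((i - j : ℕ) : ℂ) * c ((i : ℤ) - j) * a j * conj (b i) =
   ∑ i ∈ Finset.range N, ∑ j ∈ Finset.range N, ((i : ℂ) + 1) * c ((i : ℤ) - j) * a j * conj (b i) - 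
   ∑ i ∈ Finset.range N, ∑ j ∈ Finset.range N, ((min i j : ℕ) + 1 : ℂ) * c ((i : ℤ) - j) * a j * conj (b i) := by
    simp_rw [← Finset.sum_sub_distrib]
    refine Finset.sum_congr rfl fun i hi => Finset.sum_congr rfl fun j hj => ?_
    have : (i : ℂ) = ((i - j : ℕ) : ℂ) + (min i j : ℕ) := by norm_cast; omega
    rw [this]; ring
  rw [this]
  refine (norm_sub_le _ _).trans ?_
  linarith

theorem WB.coef (h : WB c t) (ht : 0 ≤ t) (N : ℕ) (a : ℕ → ℂ) :
   ∑ i ∈ Finset.range N, ‖∑ j ∈ Finset.range N, ((i - j : ℕ) : ℂ) * c ((i : ℤ) - j) * a j‖ ^ 2 / ((i:ℝ) + 1) ≤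
    4 * t ^ 2 * ∑ i ∈ Finset.range N, ((i:ℝ) + 1) * ‖a i‖ ^ 2 := by
  let d : ℕ → ℂ := fun i => ∑ j ∈ Finset.range N, ((i - j : ℕ) : ℂ) * c ((i : ℤ) - j) * a j
  have h1 := h.diff ht N a (fun i => d i / ((i:ℂ) + 1))
  have nn : ∀ i : ℕ, ‖(i:ℂ) + 1‖ = i + 1 := fun i => by
    rw [← Nat.cast_succ, Complex.norm_natCast]; push_cast; rfl
  have e1 : ∑ i ∈ Finset.range N, ((i:ℝ) + 1) * ‖d i / ((i:ℂ) + 1)‖ ^ 2 = ∑ i ∈ Finset.range N, ‖d i‖ ^ 2 / ((i:ℝ) + 1) := by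
    refine Finset.sum_congr rfl fun i hi => ?_
    rw [norm_div, nn]
    field_simp
  have e2 : ∑ i ∈ Finset.range N, ∑ j ∈ Finset.range N, ((i - j : ℕ) : ℂ) * c ((i : ℤ) - j) * a j * conj (d i / ((i:ℂ) + 1)) = 
     ((∑ i ∈ Finset.range N, ‖d i‖ ^ 2 / ((i:ℝ) + 1) : ℝ) : ℂ) := by
    push_cast
    refine Finset.sum_congr rfl fun i hi => ?_
    rw [← Finset.sum_mul]
    change d i * _ = _
    rw [map_div₀, mul_div_assoc', Complex.mul_conj']
    simp
  rw [e1, e2, Complex.norm_real] at h1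
  have n0 : 0 ≤ ∑ i ∈ Finset.range N, ‖d i‖ ^ 2 / ((i:ℝ) + 1) := Finset.sum_nonneg fun i _ => by positivity
  have n1 : 0 ≤ ∑ i ∈ Finset.range N, ((i:ℝ) + 1) * ‖a i‖ ^ 2 := Finset.sum_nonneg fun i _ => by positivity
  rw [Real.norm_of_nonneg n0] at h1
  change ∑ i ∈ Finset.range N, ‖d i‖ ^ 2 / ((i:ℝ) + 1) ≤ _
  set D := ∑ i ∈ Finset.range N, ‖d i‖ ^ 2 / ((i:ℝ) + 1)
  set A := ∑ i ∈ Finset.range N, ((i:ℝ) + 1) * ‖a i‖ ^ 2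
  have hs := Real.mul_self_sqrt n0
  have hA := Real.mul_self_sqrt n1
  have h3 : √D ≤ 2 * t * √A := by
    rcases (Real.sqrt_nonneg D).eq_or_lt with h0 | h0
    · rw [← h0]; positivity
    · refine le_of_mul_le_mul_right ?_ h0
      rw [hs]; linarith
  calc D = √D * √D := hs.symm
    _ ≤ (2 * t * √A) * (2 * t * √A) := by gcongr
    _ = 4 * t ^ 2 * (√A * √A) := by ring
    _ = _ := by rw [hA]

theorem WB.bdd (h : WB c t) (k : ℤ) : ‖c k‖ ≤ t := by
  let a : ℕ → ℂ := fun j => if j = (-k).toNat then 1 else 0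
  let b : ℕ → ℂ := fun j => if j = (k).toNat then 1 else 0
  have h1 := h.H2 (k.natAbs + 1) a b
  have e1 : ∑ i ∈ Finset.range (k.natAbs + 1), ‖a i‖ ^ 2 = 1 := by
    rw [Finset.sum_eq_single (-k).toNat]
    · simp [a]
    · intro j _ hj; simp [a, hj]
    · intro h; exact absurd (Finset.mem_range.2 (by omega)) h
  have e2 : ∑ i ∈ Finset.range (k.natAbs + 1), ‖b i‖ ^ 2 = 1 := by
    rw [Finset.sum_eq_single (k).toNat]
    · simp [b]
    · intro j _ hj; simp [b, hj]
    · intro h; exact absurd (Finset.mem_range.2 (by omega)) h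
  rw [e1, e2, Finset.sum_eq_single k.toNat, Finset.sum_eq_single (-k).toNat] at h1
  · rw [show ((k.toNat : ℤ) - (-k).toNat) = k by omega] at h1
    simpa [a, b] using h1
  · intro j _ hj; simp [a, hj]
  · intro h; exact absurd (Finset.mem_range.2 (by omega)) h
  · intro j _ hj; simp [b, hj]
  · intro h; exact absurd (Finset.mem_range.2 (by omega)) h
end discrete

section area

theorem integral_exp_int (k : ℤ) :
    ∫ θ in Set.Ioo (-Real.pi) Real.pi, Complex.exp ((k : ℂ) * Complex.I * θ) =
      if k = 0 then (2 * Real.pi : ℂ) else 0 := by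
  rw [← integral_Ioc_eq_integral_Ioo, ← intervalIntegral.integral_of_le (by linarith [Real.pi_pos])]
  split_ifs with h
  · subst h; simp; ring
  · have hk : (k : ℂ) * Complex.I ≠ 0 := by simp [h]
    rw [integral_exp_mul_complex hk, div_eq_zero_iff]
    left
    rw [sub_eq_zero, Complex.exp_eq_exp_iff_exists_int]
    refine ⟨k, ?_⟩
    push_cast; ring

theorem parseval_circle (v : ℕ → ℂ) (hv : Summable fun m => ‖v m‖) :
    ∫⁻ θ in Set.Ioo (-Real.pi) Real.pi,
      (‖∑' m, v m * Complex.exp ((m : ℂ) * Complex.I * θ)‖₊ : ℝ≥0∞) ^ 2 =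
    ENNReal.ofReal (2 * Real.pi) * ∑' m, ENNReal.ofReal (‖v m‖ ^ 2) := by
  let G : ℝ → ℂ := fun θ => ∑' m, v m * Complex.exp ((m : ℂ) * Complex.I * θ)
  have nexp : ∀ (m : ℕ) (θ : ℝ), ‖Complex.exp ((m : ℂ) * Complex.I * θ)‖ = 1 := by
    intro m θ
    rw [show (m : ℂ) * Complex.I * θ = ((m * θ : ℝ) : ℂ) * Complex.I by push_cast; ring]
    exact Complex.norm_exp_ofReal_mul_I _
  have nterm : ∀ (m : ℕ) (θ : ℝ), ‖v m * Complex.exp ((m : ℂ) * Complex.I * θ)‖ = ‖v m‖ := by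
    intro m θ; rw [norm_mul, nexp, mul_one]
  have sm : ∀ θ : ℝ, Summable fun m => ‖v m * Complex.exp ((m : ℂ) * Complex.I * θ)‖ := by
    intro θ; simp_rw [nterm]; exact hv
  have hGc : Continuous G := by
    refine continuous_tsum (fun m => by fun_prop) hv (fun m θ => (nterm m θ).le)
  let F : ℕ × ℕ → ℝ → ℂ := fun p θ =>
    (v p.1 * Complex.exp ((p.1 : ℂ) * Complex.I * θ)) * conj (v p.2 * Complex.exp ((p.2 : ℂ) * Complex.I * θ))
  have hFn : ∀ p θ, ‖F p θ‖ = ‖v p.1‖ * ‖v p.2‖ := by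
    intro p θ
    simp only [F]
    rw [norm_mul, RCLike.norm_conj, nterm, nterm]
  have hFi : ∀ p, Integrable (F p) (volume.restrict (Set.Ioo (-Real.pi) Real.pi)) := by
    intro p
    have : Continuous (F p) := by fun_prop
    exact (this.continuousOn.integrableOn_Icc).mono_set Set.Ioo_subset_Icc_self
  have hsum := hasSum_integral_of_summable_integral_norm hFi (by
    simp_rw [hFn]
    simp only [integral_const]
    exact (Summable.mul_of_nonneg hv hv (fun _ => norm_nonneg _) (fun _ => norm_nonneg _)).const_smul _)
  have hG : ∀ θ, ∑' p, F p θ = ((‖G θ‖ ^ 2 : ℝ) : ℂ) := by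
    intro θ
    have h2 : Summable fun m => ‖conj (v m * Complex.exp ((m : ℂ) * Complex.I * θ))‖ := by
      simp_rw [RCLike.norm_conj]; exact sm θ
    have := tsum_mul_tsum_of_summable_norm (sm θ) h2
    rw [← this, ← Complex.conj_tsum]
    push_cast
    exact Complex.mul_conj' _
  have hFint : ∀ p : ℕ × ℕ, ∫ θ in Set.Ioo (-Real.pi) Real.pi, F p θ =
      if p.1 = p.2 then ((2 * Real.pi * ‖v p.1‖ ^ 2 : ℝ) : ℂ) else 0 := by
    intro p
    have : ∀ θ, F p θ = v p.1 * conj (v p.2) * Complex.exp ((((p.1 : ℤ) - p.2 : ℤ) : ℂ) * Complex.I * θ) := by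
      intro θ
      simp only [F]
      rw [map_mul, ← Complex.exp_conj]
      simp only [map_mul, Complex.conj_I, Complex.conj_ofReal, map_natCast]
      rw [mul_mul_mul_comm, ← Complex.exp_add]
      congr 2
      push_cast; ring
    simp_rw [this]
    rw [integral_const_mul, integral_exp_int]
    by_cases h : p.1 = p.2
    · rw [h]
      simp [Complex.mul_conj']; ring
    · have : ¬ ((p.1 : ℤ) - p.2 = 0) := by omega
      simp [h, this]
  simp_rw [hG, hFint] at hsum
  have hs2 : HasSum (fun m : ℕ => ((2 * Real.pi * ‖v m‖ ^ 2 : ℝ) : ℂ))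
      (∫ θ in Set.Ioo (-Real.pi) Real.pi, ((‖G θ‖ ^ 2 : ℝ) : ℂ)) := by
    have inj : Function.Injective (fun m : ℕ => (m, m)) := fun a b h => (Prod.mk.inj h).1
    have := (inj.hasSum_iff (f := fun p : ℕ × ℕ => if p.1 = p.2 then ((2 * Real.pi * ‖v p.1‖ ^ 2 : ℝ) : ℂ) else 0) (a := (∫ θ in Set.Ioo (-Real.pi) Real.pi, ((‖G θ‖ ^ 2 : ℝ) : ℂ))) (by
      rintro ⟨x, y⟩ hxy
      rw [if_neg]
      rintro (rfl : x = y)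
      exact hxy ⟨x, rfl⟩)).2 hsum
    simpa [Function.comp_def] using this
  rw [integral_complex_ofReal] at hs2
  have hs3 : HasSum (fun m : ℕ => 2 * Real.pi * ‖v m‖ ^ 2) (∫ θ in Set.Ioo (-Real.pi) Real.pi, ‖G θ‖ ^ 2) := by
    exact Complex.hasSum_ofReal.1 hs2
  have hGi : Integrable (fun θ => ‖G θ‖ ^ 2) (volume.restrict (Set.Ioo (-Real.pi) Real.pi)) := by
    have : Continuous (fun θ => ‖G θ‖ ^ 2) := by fun_prop
    exact (this.continuousOn.integrableOn_Icc).mono_set Set.Ioo_subset_Icc_self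
  have h4 := ofReal_integral_eq_lintegral_ofReal hGi (Filter.Eventually.of_forall fun θ => by positivity)
  calc _ = ∫⁻ θ in Set.Ioo (-Real.pi) Real.pi, ENNReal.ofReal (‖G θ‖ ^ 2) := by
        refine lintegral_congr fun θ => ?_
        rw [ENNReal.ofReal_pow (norm_nonneg _), ofReal_norm]; rfl
    _ = _ := by
        rw [← h4, ← hs3.tsum_eq, ENNReal.ofReal_tsum_of_nonneg (fun m => by positivity) hs3.summable,
          ← ENNReal.tsum_mul_left]
        refine tsum_congr fun m => ?_
        rw [ENNReal.ofReal_mul (by positivity)]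

theorem radial_int (m : ℕ) : ∫⁻ r in Set.Ioo (0:ℝ) 1, ENNReal.ofReal (r ^ (2 * m + 1)) = ENNReal.ofReal (1 / (2 * (m + 1))) := by
  have hi : Integrable (fun r : ℝ => r ^ (2 * m + 1)) (volume.restrict (Set.Ioo (0:ℝ) 1)) := by
    have : Continuous (fun r : ℝ => r ^ (2 * m + 1)) := by fun_prop
    exact (this.continuousOn.integrableOn_Icc).mono_set Set.Ioo_subset_Icc_self
  rw [← ofReal_integral_eq_lintegral_ofReal hi, ← integral_Ioc_eq_integral_Ioo,
    ← intervalIntegral.integral_of_le zero_le_one, integral_pow]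
  · congr 1; push_cast; simp only [one_pow, ne_eq, Nat.add_eq_zero_iff, one_ne_zero, and_false, not_false_eq_true, zero_pow, sub_zero]; congr 1; ring
  · filter_upwards [ae_restrict_mem measurableSet_Ioo] with r hr
    exact pow_nonneg hr.1.le _

theorem area_formula (F : ℂ → ℂ) (b : ℕ → ℂ) (hF : Measurable ((ball (0:ℂ) 1).indicator F))
    (hb : ∀ z ∈ ball (0 : ℂ) 1, HasSum (fun m => b m * z ^ m) (F z)) :
    ∫⁻ z in ball (0 : ℂ) 1, (‖F z‖₊ : ℝ≥0∞) ^ 2 ∂((ENNReal.ofReal (Real.pi)⁻¹) • (volume : Measure ℂ)) =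
      ∑' m, ENNReal.ofReal (‖b m‖ ^ 2 / ((m : ℝ) + 1)) := by
  let Φ : ℂ → ℝ≥0∞ := fun z => (‖(ball (0:ℂ) 1).indicator F z‖₊ : ℝ≥0∞) ^ 2
  have hΦ : Measurable Φ := by fun_prop
  have e1 : ∫⁻ z in ball (0 : ℂ) 1, (‖F z‖₊ : ℝ≥0∞) ^ 2 = ∫⁻ z, Φ z := by
    rw [← lintegral_indicator measurableSet_ball]
    refine lintegral_congr fun z => ?_
    by_cases hz : z ∈ ball (0:ℂ) 1
    · simp only [Φ, Set.indicator_of_mem hz]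
    · simp only [Φ, Set.indicator_of_notMem hz]; simp
  rw [Measure.restrict_smul, lintegral_smul_measure, e1, ← Complex.lintegral_comp_polarCoord_symm]
  have hsm : Measurable (fun p : ℝ × ℝ => ENNReal.ofReal p.1 • Φ (Complex.polarCoord.symm p)) := by
    have : Measurable (fun p : ℝ × ℝ => Complex.polarCoord.symm p) := by
      simp_rw [Complex.polarCoord_symm_apply]
      fun_prop
    simp only [smul_eq_mul]
    exact (ENNReal.measurable_ofReal.comp measurable_fst).mul (hΦ.comp this)
  have inner : ∀ r ∈ Set.Ioi (0:ℝ), ∫⁻ θ in Set.Ioo (-Real.pi) Real.pi, ENNReal.ofReal r • Φ (Complex.polarCoord.symm (r, θ)) =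
      (Set.Iio (1:ℝ)).indicator (fun r => ∑' m, ENNReal.ofReal (2 * Real.pi * ‖b m‖ ^ 2) * ENNReal.ofReal (r ^ (2 * m + 1))) r := by
    intro r hr
    have hr0 : 0 < r := hr
    have hpol : ∀ θ : ℝ, Complex.polarCoord.symm (r, θ) = r * Complex.exp (θ * Complex.I) := by
      intro θ
      rw [Complex.polarCoord_symm_apply, Complex.exp_mul_I]; push_cast; rfl
    have hn : ∀ θ : ℝ, ‖(r:ℂ) * Complex.exp (θ * Complex.I)‖ = r := by
      intro θ; rw [norm_mul, Complex.norm_exp_ofReal_mul_I, Complex.norm_real, Real.norm_of_nonneg hr0.le, mul_one]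
    simp_rw [hpol, smul_eq_mul]
    by_cases h1 : r < 1
    · rw [Set.indicator_of_mem (by exact h1)]
      rw [lintegral_const_mul' _ _ ENNReal.ofReal_ne_top]
      have hrb : (r : ℂ) ∈ ball (0:ℂ) 1 := by simp [abs_of_pos hr0, h1]
      have hv : Summable fun m => ‖b m * (r:ℂ) ^ m‖ := (hb r hrb).summable.norm
      have : ∀ θ : ℝ, Φ ((r:ℂ) * Complex.exp (θ * Complex.I)) = (‖∑' m, (b m * (r:ℂ)^m) * Complex.exp ((m : ℂ) * Complex.I * θ)‖₊ : ℝ≥0∞) ^ 2 := by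
        intro θ
        have hz : (r:ℂ) * Complex.exp (θ * Complex.I) ∈ ball (0:ℂ) 1 := by
          rw [mem_ball_zero_iff, hn]; exact h1
        simp only [Φ, Set.indicator_of_mem hz]
        rw [← (hb _ hz).tsum_eq]
        congr 4
        funext m
        rw [mul_pow, ← Complex.exp_nat_mul, ← mul_assoc]
        congr 2; ring
      simp_rw [this]
      rw [parseval_circle _ hv, ← mul_assoc, ← ENNReal.tsum_mul_left]
      refine tsum_congr fun m => ?_
      rw [← ENNReal.ofReal_mul hr0.le, ← ENNReal.ofReal_mul (by positivity), ← ENNReal.ofReal_mul (by positivity)]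
      congr 1
      rw [norm_mul, norm_pow, Complex.norm_real, Real.norm_of_nonneg hr0.le]; ring
    · rw [Set.indicator_of_notMem (by exact h1)]
      have : ∀ θ : ℝ, Φ ((r:ℂ) * Complex.exp (θ * Complex.I)) = 0 := by
        intro θ
        have hz : (r:ℂ) * Complex.exp (θ * Complex.I) ∉ ball (0:ℂ) 1 := by
          rw [mem_ball_zero_iff, hn]; exact h1
        simp only [Φ, Set.indicator_of_notMem hz]; simp
      simp [this]
  rw [show polarCoord.target = Set.Ioi (0:ℝ) ×ˢ Set.Ioo (-Real.pi) Real.pi from rfl, Measure.volume_eq_prod,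
    setLIntegral_prod _ hsm.aemeasurable, setLIntegral_congr_fun measurableSet_Ioi inner,
    setLIntegral_indicator measurableSet_Iio, Set.inter_comm, Set.Ioi_inter_Iio,
    lintegral_tsum (fun m => by fun_prop), smul_eq_mul, ← ENNReal.tsum_mul_left]
  refine tsum_congr fun m => ?_
  rw [lintegral_const_mul' _ _ ENNReal.ofReal_ne_top, radial_int, ← ENNReal.ofReal_mul (by positivity), ← ENNReal.ofReal_mul (by positivity)]
  congr 1
  have := Real.pi_pos.ne'
  field_simp
end area

section symbol
variable {c : ℤ → ℂ} {t : ℝ}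

theorem WB.summ (h : WB c t) (u : ℕ → ℤ) (z : ℂ) (hz : ‖z‖ < 1) : Summable fun k : ℕ => ‖c (u k) * z ^ k‖ := by
  refine Summable.of_nonneg_of_le (fun _ => norm_nonneg _) (fun k => ?_) ((summable_geometric_of_lt_one (norm_nonneg z) hz).mul_left t)
  rw [norm_mul, norm_pow]
  exact mul_le_mul_of_nonneg_right (h.bdd _) (by positivity)

theorem WB.summ' (h : WB c t) (z : ℂ) (hz : ‖z‖ < 1) : Summable fun k : ℕ => ‖c ((k:ℤ)+1) * z ^ (k+1)‖ := by
  have := (summable_nat_add_iff 1).2 (h.summ (fun k => k) z hz)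
  simpa using this

theorem WB.symbol (h : WB c t) (ht : 0 ≤ t) (z : ℂ) (hz : ‖z‖ < 1) :
    ‖(∑' k : ℕ, c ((k : ℤ) + 1) * z ^ (k + 1)) + ∑' k : ℕ, c (-(k : ℤ)) * (conj z) ^ k‖ ≤ t := by
  let F : ℕ × ℕ → ℂ := fun p => c ((p.1 : ℤ) - p.2) * (conj z) ^ p.2 * z ^ p.1
  have hg := summable_geometric_of_lt_one (norm_nonneg z) hz
  have hF : Summable F := by
    refine Summable.of_norm_bounded (g := fun p : ℕ × ℕ => t * (‖z‖ ^ p.1 * ‖z‖ ^ p.2))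
      ((Summable.mul_of_nonneg hg hg (fun _ => by positivity) (fun _ => by positivity)).mul_left t) fun p => ?_
    simp only [F]
    rw [norm_mul, norm_mul, norm_pow, norm_pow, RCLike.norm_conj]
    have := mul_le_mul_of_nonneg_right (h.bdd ((p.1 : ℤ) - p.2)) (by positivity : 0 ≤ ‖z‖ ^ p.2 * ‖z‖ ^ p.1)
    linarith
  have hzz : z * conj z = ((‖z‖^2 : ℝ) : ℂ) := by push_cast; exact Complex.mul_conj' z
  have hq : 0 ≤ ‖z‖^2 := by positivity
  have hq1 : ‖z‖^2 < 1 := by nlinarith [norm_nonneg z]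
  have hbd : ‖∑' p, F p‖ ≤ t * (1 - ‖z‖^2)⁻¹ := by
    have lim : Filter.Tendsto (fun N : ℕ => ∑ p ∈ Finset.range N ×ˢ Finset.range N, F p) Filter.atTop (nhds (∑' p, F p)) :=
      hF.hasSum.comp (Filter.tendsto_atTop_finset_of_monotone
        (fun _ _ hMN => Finset.product_subset_product (Finset.range_mono hMN) (Finset.range_mono hMN))
        (fun p => ⟨p.1 + p.2 + 1, by simp only [Finset.mem_product, Finset.mem_range]; omega⟩))
    refine le_of_tendsto' lim.norm fun N => ?_
    rw [Finset.sum_product]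
    have := h.H2 N (fun j => (conj z)^j) (fun j => (conj z)^j)
    rw [Real.mul_self_sqrt (Finset.sum_nonneg fun i _ => by positivity)] at this
    simp only [map_pow, Complex.conj_conj] at this
    refine this.trans (mul_le_mul_of_nonneg_left ?_ ht)
    rw [← tsum_geometric_of_lt_one hq hq1]
    have e : ∀ i, ‖(conj z)^i‖^2 = (‖z‖^2)^i := by
      intro i; rw [norm_pow, RCLike.norm_conj]; ring
    simp_rw [e]
    exact (summable_geometric_of_lt_one hq hq1).sum_le_tsum _ (fun _ _ => by positivity)
  have hsplit : ∑' p, F p = ((∑' k : ℕ, c ((k : ℤ) + 1) * z ^ (k + 1)) + ∑' k : ℕ, c (-(k : ℤ)) * (conj z) ^ k) + ((‖z‖^2 : ℝ) : ℂ) * ∑' p, F p := by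
    have hrow : ∀ i, Summable fun j => F (i, j) := fun i => hF.prod_factor i
    have hG : Summable fun i => ∑' j, F (i, j) := hF.prod
    have e1 : ∑' p, F p = ∑' i, ∑' j, F (i,j) := hF.tsum_prod
    have e2 : ∑' i, ∑' j, F (i,j) = ∑' j, F (0,j) + ∑' i, ∑' j, F (i+1,j) := hG.tsum_eq_zero_add
    have e3 : ∀ i, ∑' j, F (i+1,j) = F (i+1, 0) + ((‖z‖^2 : ℝ) : ℂ) * ∑' j, F (i, j) := by
      intro i
      rw [(hrow (i+1)).tsum_eq_zero_add, ← tsum_mul_left]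
      congr 1
      refine tsum_congr fun j => ?_
      simp only [F]
      rw [← hzz]
      push_cast
      rw [show (i:ℤ) + 1 - (j + 1) = i - j by ring]; ring
    have e4 : ∑' i, ∑' j, F (i+1,j) = ∑' i, F (i+1, 0) + ((‖z‖^2 : ℝ) : ℂ) * ∑' p, F p := by
      simp_rw [e3]
      rw [Summable.tsum_add _ (hG.mul_left _), tsum_mul_left, ← e1]
      have := (h.summ' z hz).of_norm
      simpa [F] using this
    have e5 : ∑' j, F (0,j) = ∑' k : ℕ, c (-(k : ℤ)) * (conj z) ^ k := by simp [F]
    have e6 : ∑' i, F (i+1, 0) = ∑' k : ℕ, c ((k : ℤ) + 1) * z ^ (k + 1) := by simp [F]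
    conv_lhs => rw [e1, e2, e4, e5, e6]
    ring
  have : (∑' k : ℕ, c ((k : ℤ) + 1) * z ^ (k + 1)) + ∑' k : ℕ, c (-(k : ℤ)) * (conj z) ^ k = ((1 - ‖z‖^2 : ℝ) : ℂ) * ∑' p, F p := by
    push_cast at hsplit ⊢
    linear_combination -hsplit
  rw [this, norm_mul, Complex.norm_real, Real.norm_of_nonneg (by linarith)]
  calc _ ≤ (1 - ‖z‖^2) * (t * (1 - ‖z‖^2)⁻¹) := mul_le_mul_of_nonneg_left hbd (by linarith)
    _ = t := by have : 1 - ‖z‖^2 ≠ 0 := by linarith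
                field_simp

theorem WB.hasSum_deriv (h : WB c t) (ht : 0 ≤ t) (z : ℂ) (hz : z ∈ ball (0:ℂ) 1) :
    HasSum (fun k : ℕ => (((k:ℂ) + 1) * c ((k:ℤ) + 1)) * z ^ k) (deriv (fun x : ℂ => ∑' k : ℕ, c ((k : ℤ) + 1) * x ^ (k + 1)) z) := by
  rw [mem_ball_zero_iff] at hz
  obtain ⟨ρ, h1, h2⟩ := exists_between hz
  have hρ : 0 ≤ ρ := (norm_nonneg z).trans h1.le
  have := Complex.hasSum_deriv_of_summable_norm (F := fun (k : ℕ) (x : ℂ) => c ((k : ℤ) + 1) * x ^ (k + 1)) (U := ball 0 ρ) (z := z)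
    (u := fun k => t * ρ ^ (k+1)) (((summable_nat_add_iff 1).2 (summable_geometric_of_lt_one hρ h2)).mul_left t)
    (fun k => by fun_prop) isOpen_ball (fun k w hw => by
      rw [mem_ball_zero_iff] at hw
      rw [norm_mul, norm_pow]
      exact mul_le_mul (h.bdd _) (pow_le_pow_left₀ (norm_nonneg _) hw.le _) (by positivity) ht) (by rwa [mem_ball_zero_iff])
  have e : ∀ k : ℕ, deriv (fun x : ℂ => c ((k : ℤ) + 1) * x ^ (k + 1)) z = (((k:ℂ) + 1) * c ((k:ℤ) + 1)) * z ^ k := by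
    intro k
    rw [deriv_const_mul_field, deriv_pow_field]
    push_cast
    ring
  simp_rw [e] at this
  exact this

theorem WB.carleson (h : WB c t) (ht : 0 ≤ t) (f : ℂ → ℂ)
    (hf : DifferentiableOn ℂ f (ball (0 : ℂ) 1)) (hf0 : f 0 = 0) :
        (∫⁻ z in ball (0 : ℂ) 1,
            (‖f z‖₊ : ℝ≥0∞) ^ 2 *
              (‖deriv (fun x : ℂ => ∑' k : ℕ, c ((k : ℤ) + 1) * x ^ (k + 1)) z‖₊ : ℝ≥0∞) ^ 2
          ∂((ENNReal.ofReal (Real.pi)⁻¹) • (volume : Measure ℂ)))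
          ≤ ENNReal.ofReal (4 * t ^ 2 + 1) *
            ∫⁻ z in ball (0 : ℂ) 1, (‖deriv f z‖₊ : ℝ≥0∞) ^ 2 ∂((ENNReal.ofReal (Real.pi)⁻¹) • (volume : Measure ℂ)) := by
  let g' : ℂ → ℂ := deriv (fun x : ℂ => ∑' k : ℕ, c ((k : ℤ) + 1) * x ^ (k + 1))
  let a : ℕ → ℂ := fun n => (n.factorial : ℂ)⁻¹ * iteratedDeriv n f 0
  let w : ℕ → ℂ := fun k => ((k:ℂ) + 1) * c ((k:ℤ) + 1)
  let b : ℕ → ℂ := fun m => ∑ p ∈ Finset.HasAntidiagonal.antidiagonal m, a p.1 * w p.2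
  have ha0 : a 0 = 0 := by simp [a, hf0]
  have hfs : ∀ z ∈ ball (0:ℂ) 1, HasSum (fun n => a n * z ^ n) (f z) := by
    intro z hz
    have h1 := Complex.hasSum_taylorSeries_on_ball hf hz
    refine (congrArg (fun u : ℕ → ℂ => HasSum u _) (funext fun n => ?_)).mp h1
    simp only [a, sub_zero, smul_eq_mul]; ring
  have hdf : DifferentiableOn ℂ (deriv f) (ball (0:ℂ) 1) := hf.deriv isOpen_ball
  have hfs' : ∀ z ∈ ball (0:ℂ) 1, HasSum (fun n : ℕ => (((n:ℂ) + 1) * a (n+1)) * z ^ n) (deriv f z) := by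
    intro z hz
    have h1 := Complex.hasSum_taylorSeries_on_ball hdf hz
    refine (congrArg (fun u : ℕ → ℂ => HasSum u _) (funext fun n => ?_)).mp h1
    simp only [a, iteratedDeriv_succ', Nat.factorial_succ, sub_zero, smul_eq_mul]
    have : (n:ℂ) + 1 ≠ 0 := by exact_mod_cast Nat.succ_ne_zero n
    have : (n.factorial : ℂ) ≠ 0 := by exact_mod_cast n.factorial_ne_zero
    push_cast
    field_simp
  have hbs : ∀ z ∈ ball (0:ℂ) 1, HasSum (fun n => b n * z ^ n) (f z * g' z) := by
    intro z hz
    have h1 := hfs z hz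
    have h2 : HasSum (fun k => w k * z ^ k) (g' z) := h.hasSum_deriv ht z hz
    have e : ∀ n, b n * z ^ n = ∑ p ∈ Finset.HasAntidiagonal.antidiagonal n, (a p.1 * z ^ p.1) * (w p.2 * z ^ p.2) := by
      intro n
      simp only [b]
      rw [Finset.sum_mul]
      refine Finset.sum_congr rfl fun p hp => ?_
      rw [← Finset.HasAntidiagonal.mem_antidiagonal.1 hp, pow_add]; ring
    simp_rw [e]
    rw [← h1.tsum_eq, ← h2.tsum_eq, tsum_mul_tsum_eq_tsum_sum_antidiagonal_of_summable_norm h1.summable.norm h2.summable.norm]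
    exact (summable_norm_sum_mul_antidiagonal_of_summable_norm h1.summable.norm h2.summable.norm).of_norm.hasSum
  have hb : ∀ N, ∀ i < N, b i = ∑ j ∈ Finset.range N, ((i - j : ℕ) : ℂ) * c ((i : ℤ) - j) * a (j + 1) := by
    intro N i hi
    simp only [b]
    rw [Finset.Nat.sum_antidiagonal_eq_sum_range_succ (fun x y => a x * w y), Finset.sum_range_succ', ha0, zero_mul, add_zero]
    rw [← Finset.sum_subset (Finset.range_mono hi.le)]
    · refine Finset.sum_congr rfl fun j hj => ?_
      rw [Finset.mem_range] at hj
      simp only [w]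
      have e1 : ((i - (j+1) : ℕ) : ℤ) + 1 = i - j := by omega
      have e2 : ((i - (j+1) : ℕ) : ℂ) + 1 = ((i - j : ℕ) : ℂ) := by norm_cast; omega
      rw [e1, e2]; ring
    · intro j _ hj
      rw [Finset.mem_range, not_lt] at hj
      simp [Nat.sub_eq_zero_of_le hj]
  have mf : Measurable ((ball (0:ℂ) 1).indicator f) := by
    classical
    rw [← Set.piecewise_eq_indicator]
    exact hf.continuousOn.measurable_piecewise continuousOn_const measurableSet_ball
  have m1 : Measurable ((ball (0:ℂ) 1).indicator (fun z => f z * g' z)) := by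
    have : (ball (0:ℂ) 1).indicator (fun z => f z * g' z) = fun z => (ball (0:ℂ) 1).indicator f z * g' z := by
      funext z; rw [← Set.indicator_mul_left]
    rw [this]
    exact mf.mul (measurable_deriv _)
  have m2 : Measurable ((ball (0:ℂ) 1).indicator (deriv f)) := (measurable_deriv f).indicator measurableSet_ball
  rw [area_formula _ _ m2 hfs']
  have e1 := area_formula _ _ m1 hbs
  simp_rw [nnnorm_mul, ENNReal.coe_mul, mul_pow] at e1
  change (∫⁻ z in ball (0 : ℂ) 1, (‖f z‖₊ : ℝ≥0∞) ^ 2 * (‖g' z‖₊ : ℝ≥0∞) ^ 2 ∂((ENNReal.ofReal (Real.pi)⁻¹) • (volume : Measure ℂ))) ≤ _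
  rw [e1]
  refine ENNReal.tsum_le_of_sum_range_le fun N => ?_
  have key := h.coef ht N (fun j => a (j+1))
  have e2 : ∀ i : ℕ, ‖((i:ℂ) + 1) * a (i+1)‖ ^ 2 / ((i:ℝ) + 1) = ((i:ℝ) + 1) * ‖a (i+1)‖ ^ 2 := by
    intro i
    rw [norm_mul, ← Nat.cast_succ, Complex.norm_natCast]; push_cast; field_simp
  have hnn : 0 ≤ ∑ i ∈ Finset.range N, ((i:ℝ) + 1) * ‖a (i+1)‖ ^ 2 := Finset.sum_nonneg fun i _ => by positivity
  calc ∑ i ∈ Finset.range N, ENNReal.ofReal (‖b i‖ ^ 2 / ((i:ℝ) + 1)) = ENNReal.ofReal (∑ i ∈ Finset.range N, ‖b i‖ ^ 2 / ((i:ℝ) + 1)) :=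
        (ENNReal.ofReal_sum_of_nonneg fun i _ => by positivity).symm
    _ ≤ ENNReal.ofReal ((4 * t ^ 2 + 1) * ∑ i ∈ Finset.range N, ((i:ℝ) + 1) * ‖a (i+1)‖ ^ 2) := by
        refine ENNReal.ofReal_le_ofReal ?_
        rw [Finset.sum_congr rfl fun i hi => by rw [hb N i (Finset.mem_range.1 hi)]]
        linarith
    _ = ENNReal.ofReal (4 * t ^ 2 + 1) * ∑ i ∈ Finset.range N, ENNReal.ofReal (‖((i:ℂ) + 1) * a (i+1)‖ ^ 2 / ((i:ℝ) + 1)) := by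
        rw [ENNReal.ofReal_mul (by positivity), ENNReal.ofReal_sum_of_nonneg fun i _ => by positivity]
        simp_rw [e2]
    _ ≤ _ := by
        gcongr
        exact ENNReal.sum_le_tsum _
end symbol

/-- Brown–Halmos theorem for the Dirichlet space (coefficient model). -/
theorem statement17 {H : Type*} [NormedAddCommGroup H] [InnerProductSpace ℂ H]
    [CompleteSpace H]
    (e : ℕ → H)
    (horth : ∀ m n : ℕ, 1 ≤ m → 1 ≤ n → ⟪e m, e n⟫ = if m = n then (m : ℂ) else 0)
    (hdense : Dense (Submodule.span ℂ (e '' {n : ℕ | 1 ≤ n}) : Set H))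
    (S B : H →L[ℂ] H)
    (hS : ∀ n : ℕ, 1 ≤ n → S (e n) = e (n + 1))
    (hB1 : B (e 1) = 0)
    (hB : ∀ n : ℕ, 1 ≤ n → B (e (n + 1)) = e n)
    (T : H →L[ℂ] H)
    (hT : B ∘L (T ∘L S) = T) :
    ∃ c : ℤ → ℂ,
      -- `T` has Toeplitz matrix with coefficient sequence `c` ...
      (∀ m n : ℕ, 1 ≤ m → 1 ≤ n → ⟪e m, T (e n)⟫ = (m : ℂ) * c ((m : ℤ) - n)) ∧
      -- ... and `c` is unique with this property
      (∀ c' : ℤ → ℂ,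
        (∀ m n : ℕ, 1 ≤ m → 1 ≤ n → ⟪e m, T (e n)⟫ = (m : ℂ) * c' ((m : ℤ) - n)) →
        c' = c) ∧
      -- (i) the series defining the symbol converge absolutely on 𝔻 and the symbol is
      -- bounded by ‖T‖
      (∀ z ∈ ball (0 : ℂ) 1,
        Summable (fun k : ℕ => ‖c ((k : ℤ) + 1) * z ^ (k + 1)‖) ∧
        Summable (fun k : ℕ => ‖c (-(k : ℤ)) * (conj z) ^ k‖) ∧
        ‖(∑' k : ℕ, c ((k : ℤ) + 1) * z ^ (k + 1)) + ∑' k : ℕ, c (-(k : ℤ)) * (conj z) ^ k‖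
          ≤ ‖T‖) ∧
      -- (ii) `|g′|² dA` is a Carleson measure for the Dirichlet space, where
      -- `g(z) = Σ_{k ≥ 1} c(k) z^k` is the holomorphic part of the symbol
      (∃ C : ℝ, 0 < C ∧ ∀ f : ℂ → ℂ,
        DifferentiableOn ℂ f (ball (0 : ℂ) 1) → f 0 = 0 →
        (∫⁻ z in ball (0 : ℂ) 1, (‖deriv f z‖₊ : ℝ≥0∞) ^ 2 ∂dA) < ⊤ →
        (∫⁻ z in ball (0 : ℂ) 1,
            (‖f z‖₊ : ℝ≥0∞) ^ 2 *
              (‖deriv (fun x : ℂ => ∑' k : ℕ, c ((k : ℤ) + 1) * x ^ (k + 1)) z‖₊ : ℝ≥0∞) ^ 2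
          ∂dA)
          ≤ ENNReal.ofReal C *
            ∫⁻ z in ball (0 : ℂ) 1, (‖deriv f z‖₊ : ℝ≥0∞) ^ 2 ∂dA) := by
  obtain ⟨c, hc⟩ := toep_coef e horth hdense S B hS hB1 hB T hT
  have h := toep_WB e horth T c hc
  refine ⟨c, hc, ?_, ?_, 4 * ‖T‖ ^ 2 + 1, by positivity, ?_⟩
  · intro c' hc'
    funext k
    have h1 := hc (k.toNat + 1) ((-k).toNat + 1) (by omega) (by omega)
    have h2 := hc' (k.toNat + 1) ((-k).toNat + 1) (by omega) (by omega)
    rw [h1, show (((k.toNat + 1 : ℕ) : ℤ) - ((-k).toNat + 1 : ℕ)) = k by omega] at h2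
    exact (mul_left_cancel₀ (Nat.cast_ne_zero.2 (Nat.succ_ne_zero _)) h2).symm
  · intro z hz
    rw [mem_ball_zero_iff] at hz
    exact ⟨h.summ' z hz, h.summ (fun k => -(k : ℤ)) (conj z) (by rwa [RCLike.norm_conj]),
      h.symbol (norm_nonneg T) z hz⟩
  · intro f hf hf0 _
    exact h.carleson (norm_nonneg T) f hf hf0
end

section
/- Let g, h be holomorphic functions on 𝔻 such that ∫_𝔻 |g′|² dA < ∞ and φ := g + conj∘h is bounded on 𝔻. Then for every complex polynomial f with f(0) = 0 and every w ∈ 𝔻, the function T_φ f is differentiable at w and (T_φ f)′(w) = g′(w)·f(w) + ∫_𝔻 φ(z)·f′(z)·(1 − w·conj(z))^{−2} dA(z); that is, (T_φ f)′ = (∂φ/∂z)·f + P_{A²}(φ f′), where P_{A²} is the Bergman projection with kernel (1 − w·conj(z))^{−2}. -/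
open MeasureTheory Metric
open scoped ENNReal ComplexConjugate

/-- The Toeplitz operator with harmonic symbol `φ = g + conj ∘ h` on the Dirichlet space:
`(T_φ f)(w) = ∫_𝔻 (g′(z) f(z) + φ(z) f′(z)) · (w / (1 − w · conj z)) dA(z)`. -/
noncomputable def toeplitz (g φ f : ℂ → ℂ) : ℂ → ℂ :=
  fun w => ∫ z in ball (0 : ℂ) 1,
    (deriv g z * f z + φ z * deriv f z) * (w / (1 - w * conj z)) ∂dA

theorem aux_circle (F : ℂ → ℂ) (hF : DifferentiableOn ℂ F (ball (0 : ℂ) 1)) (w : ℂ)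
    (hw : ‖w‖ < 1) (r : ℝ) (h0 : 0 < r) (h1 : r < 1) :
    ∫ θ in Set.Ioo (-Real.pi) Real.pi,
      F (circleMap 0 r θ) * ((1 - w * conj (circleMap 0 r θ)) ^ 2)⁻¹
    = 2 * Real.pi * deriv (fun z => z * F z) ((r : ℂ) ^ 2 * w) := by
  have hsub : closedBall (0 : ℂ) r ⊆ ball 0 1 := closedBall_subset_ball h1
  have hmem : (r : ℂ) ^ 2 * w ∈ ball (0 : ℂ) r := by
    rw [mem_ball_zero_iff, norm_mul, norm_pow, Complex.norm_real, Real.norm_of_nonneg h0.le]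
    nlinarith [norm_nonneg w]
  have key := Complex.two_pi_I_inv_smul_circleIntegral_sub_sq_inv_smul_of_differentiable
    isOpen_ball hsub (f := fun z => z * F z) (differentiableOn_id.mul hF) hmem
  rw [← key, circleIntegral, ← integral_Ioc_eq_integral_Ioo,
    ← intervalIntegral.integral_of_le (by linarith [Real.pi_pos])]
  have hper : Function.Periodic (fun θ => F (circleMap 0 r θ) *
      ((1 - w * conj (circleMap 0 r θ)) ^ 2)⁻¹) (2 * Real.pi) := by
    intro θ
    simp only [periodic_circleMap 0 r θ]
  have h2 := hper.intervalIntegral_add_eq (-Real.pi) 0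
  rw [show -Real.pi + 2 * Real.pi = Real.pi by ring, zero_add] at h2
  rw [h2]
  have h3 : ∀ θ : ℝ, deriv (circleMap 0 r) θ • ((circleMap 0 r θ - (r : ℂ) ^ 2 * w) ^ 2)⁻¹ •
      (circleMap 0 r θ * F (circleMap 0 r θ)) = Complex.I * (F (circleMap 0 r θ) *
      ((1 - w * conj (circleMap 0 r θ)) ^ 2)⁻¹) := by
    intro θ
    rw [deriv_circleMap]
    have hz : circleMap 0 r θ ≠ 0 := circleMap_ne_center h0.ne'
    have hn : ‖circleMap 0 r θ‖ = r := by simp [abs_of_pos h0]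
    have hcc : circleMap 0 r θ * conj (circleMap 0 r θ) = (r : ℂ) ^ 2 := by
      rw [Complex.mul_conj, Complex.normSq_eq_norm_sq, hn]; push_cast; rfl
    generalize circleMap 0 r θ = z at *
    have : z - (r : ℂ) ^ 2 * w = z * (1 - w * conj z) := by rw [← hcc]; ring
    rw [this]
    simp only [smul_eq_mul]
    rw [mul_pow, mul_inv]
    field_simp
  simp_rw [h3]
  rw [intervalIntegral.integral_const_mul, smul_eq_mul]
  have : (Real.pi : ℂ) ≠ 0 := by exact_mod_cast Real.pi_ne_zero
  field_simp

theorem aux_polar (K : ℂ → ℂ) (hc : ContinuousOn K (ball (0 : ℂ) 1))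
    (hi : IntegrableOn K (ball (0 : ℂ) 1)) :
    ∫ z in ball (0 : ℂ) 1, K z = ∫ r in Set.Ioo (0 : ℝ) 1,
      ∫ θ in Set.Ioo (-Real.pi) Real.pi, (r : ℂ) * K (circleMap 0 r θ) := by
  set S : Set (ℝ × ℝ) := Set.Ioo (0 : ℝ) 1 ×ˢ Set.Ioo (-Real.pi) Real.pi with hS
  have hSm : MeasurableSet S := measurableSet_Ioo.prod measurableSet_Ioo
  have hST : S ⊆ polarCoord.target := by
    rintro ⟨a, b⟩ ⟨h1, h2⟩
    exact ⟨h1.1, h2⟩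
  have hsymm : ∀ p : ℝ × ℝ, Complex.polarCoord.symm p = circleMap 0 p.1 p.2 := by
    intro p
    simp [circleMap, Complex.exp_mul_I]
  have hball : ∀ p ∈ polarCoord.target, (circleMap 0 p.1 p.2 ∈ ball (0 : ℂ) 1 ↔ p ∈ S) := by
    rintro ⟨a, b⟩ ⟨h1, h2⟩
    have h1 : 0 < a := h1
    simp only [mem_ball_zero_iff, norm_circleMap_zero, abs_of_pos h1, hS, Set.mem_prod]
    exact ⟨fun h => ⟨⟨h1, h⟩, h2⟩, fun h => h.1.2⟩
  have hcont : ContinuousOn (fun p : ℝ × ℝ => (p.1 : ℂ) * K (circleMap 0 p.1 p.2)) S := by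
    refine ContinuousOn.mul (by fun_prop) (hc.comp (by unfold circleMap; fun_prop) ?_)
    intro p hp
    exact (hball p (hST hp)).2 hp
  have hint : IntegrableOn (fun p : ℝ × ℝ => (p.1 : ℂ) * K (circleMap 0 p.1 p.2)) S := by
    refine ⟨hcont.aestronglyMeasurable hSm, ?_⟩
    have h1 := Complex.lintegral_comp_polarCoord_symm
      ((ball (0 : ℂ) 1).indicator fun z => ‖K z‖ₑ)
    rw [lintegral_indicator measurableSet_ball] at h1
    have h2 : ∫⁻ z in ball (0 : ℂ) 1, ‖K z‖ₑ < ⊤ := hi.2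
    rw [← h1] at h2
    refine lt_of_le_of_lt ?_ h2
    refine le_trans ?_ (lintegral_mono_set hST)
    refine le_of_eq (setLIntegral_congr_fun hSm fun p hp => ?_)
    have hp' := (hball p (hST hp)).2 hp
    simp only [hsymm, Set.indicator_of_mem hp', smul_eq_mul, enorm_mul]
    congr 1
    have : 0 < p.1 := hp.1.1
    rw [← ofReal_norm_eq_enorm, Complex.norm_real, Real.norm_of_nonneg this.le]
  rw [← integral_indicator measurableSet_ball, ← Complex.integral_comp_polarCoord_symm]
  have h4 : ∀ p ∈ polarCoord.target, p.1 • (ball (0 : ℂ) 1).indicator K (Complex.polarCoord.symm p)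
      = S.indicator (fun p : ℝ × ℝ => (p.1 : ℂ) * K (circleMap 0 p.1 p.2)) p := by
    intro p hp
    rw [hsymm]
    by_cases h : p ∈ S
    · rw [Set.indicator_of_mem h, Set.indicator_of_mem ((hball p hp).2 h)]
      simp
    · rw [Set.indicator_of_notMem h, Set.indicator_of_notMem (fun h' => h ((hball p hp).1 h'))]
      simp
  rw [setIntegral_congr_fun polarCoord.open_target.measurableSet h4,
    setIntegral_indicator hSm, Set.inter_eq_right.2 hST]
  exact setIntegral_prod _ hint

theorem aux_ne {w z : ℂ} {ρ : ℝ} (hw : ‖w‖ ≤ ρ) (hz : z ∈ ball (0 : ℂ) 1) :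
    1 - ρ ≤ ‖1 - w * conj z‖ := by
  have hz : ‖z‖ < 1 := by simpa using hz
  have h1 : ‖w * conj z‖ ≤ ρ := by
    rw [norm_mul, RCLike.norm_conj]
    nlinarith [norm_nonneg w, norm_nonneg z]
  have := norm_sub_norm_le (1 : ℂ) (w * conj z)
  rw [norm_one] at this
  linarith

theorem aux_ne0 {w z : ℂ} (hw : ‖w‖ < 1) (hz : z ∈ ball (0 : ℂ) 1) :
    1 - w * conj z ≠ 0 := by
  have := aux_ne le_rfl hz (w := w)
  exact norm_pos_iff.1 (by linarith)

theorem aux_contK {w : ℂ} (hw : ‖w‖ < 1) :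
    ContinuousOn (fun z => ((1 - w * conj z) ^ 2)⁻¹) (ball (0 : ℂ) 1) := by
  refine ContinuousOn.inv₀ ?_ fun z hz => pow_ne_zero 2 (aux_ne0 hw hz)
  exact ((continuous_const.sub (continuous_const.mul Complex.continuous_conj)).pow 2).continuousOn

theorem aux_normK {w z : ℂ} {ρ : ℝ} (hρ : ρ < 1) (hw : ‖w‖ ≤ ρ) (hz : z ∈ ball (0 : ℂ) 1) :
    ‖((1 - w * conj z) ^ 2)⁻¹‖ ≤ ((1 - ρ) ^ 2)⁻¹ := by
  rw [norm_inv, norm_pow]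
  have := aux_ne hw hz
  have : 0 < 1 - ρ := by linarith
  gcongr

theorem aux_int {G : ℂ → ℂ} (hG : IntegrableOn G (ball (0 : ℂ) 1)) {w : ℂ} (hw : ‖w‖ < 1) :
    IntegrableOn (fun z => G z * ((1 - w * conj z) ^ 2)⁻¹) (ball (0 : ℂ) 1) := by
  refine Integrable.mul_bdd (c := ((1 - ‖w‖) ^ 2)⁻¹) hG
    ((aux_contK hw).aestronglyMeasurable measurableSet_ball) ?_
  filter_upwards [ae_restrict_mem measurableSet_ball] with z hz
  exact aux_normK hw le_rfl hz

theorem aux_repro (F : ℂ → ℂ) (hF : DifferentiableOn ℂ F (ball (0 : ℂ) 1))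
    (hi : IntegrableOn F (ball (0 : ℂ) 1)) (w : ℂ) (hw : ‖w‖ < 1) :
    ∫ z in ball (0 : ℂ) 1, F z * ((1 - w * conj z) ^ 2)⁻¹ = Real.pi * F w := by
  rw [aux_polar (fun z => F z * ((1 - w * conj z) ^ 2)⁻¹) (hF.continuousOn.mul (aux_contK hw)) (aux_int hi hw)]
  have h1 : ∀ r ∈ Set.Ioo (0 : ℝ) 1, (∫ θ in Set.Ioo (-Real.pi) Real.pi,
      (r : ℂ) * (F (circleMap 0 r θ) * ((1 - w * conj (circleMap 0 r θ)) ^ 2)⁻¹)) =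
      Real.pi * (2 * r * deriv (fun z => z * F z) ((r : ℂ) ^ 2 * w)) := by
    intro r hr
    rw [integral_const_mul, aux_circle F hF w hw r hr.1 hr.2]
    ring
  rw [setIntegral_congr_fun measurableSet_Ioo h1, integral_const_mul]
  congr 1
  rw [← integral_Ioc_eq_integral_Ioo, ← intervalIntegral.integral_of_le zero_le_one]
  have hmem : ∀ r ∈ Set.uIcc (0 : ℝ) 1, (r : ℂ) ^ 2 * w ∈ ball (0 : ℂ) 1 := by
    intro r hr
    rw [Set.uIcc_of_le zero_le_one] at hr
    rw [mem_ball_zero_iff, norm_mul, norm_pow, Complex.norm_real, Real.norm_of_nonneg hr.1]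
    have := hr.1
    have := hr.2
    have : r ^ 2 ≤ 1 := by nlinarith
    nlinarith [norm_nonneg w]
  have hdz : DifferentiableOn ℂ (fun z => z * F z) (ball (0 : ℂ) 1) := differentiableOn_id.mul hF
  have hder : ∀ r ∈ Set.uIcc (0 : ℝ) 1, HasDerivAt (fun r : ℝ => (r : ℂ) ^ 2 * F ((r : ℂ) ^ 2 * w))
      (2 * r * deriv (fun z => z * F z) ((r : ℂ) ^ 2 * w)) r := by
    intro r hr
    have hFd := (hF.differentiableAt (isOpen_ball.mem_nhds (hmem r hr))).hasDerivAt
    have hd : deriv (fun z => z * F z) ((r : ℂ) ^ 2 * w) = 1 * F ((r : ℂ) ^ 2 * w) +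
        ((r : ℂ) ^ 2 * w) * deriv F ((r : ℂ) ^ 2 * w) :=
      ((hasDerivAt_id' _).mul hFd).deriv
    have hsq : HasDerivAt (fun r : ℂ => r ^ 2) (2 * r) (r : ℂ) := by
      simpa using hasDerivAt_pow 2 (r : ℂ)
    have := (hsq.mul (HasDerivAt.comp (r : ℂ) (h₂ := F) hFd (hsq.mul_const w))).comp_ofReal
    refine this.congr_deriv ?_
    rw [hd]
    simp only [Function.comp]
    ring
  rw [intervalIntegral.integral_eq_sub_of_hasDerivAt hder]
  · simp
  · apply ContinuousOn.intervalIntegrable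
    refine ContinuousOn.mul (by fun_prop) ?_
    exact (hdz.deriv isOpen_ball).continuousOn.comp (by fun_prop) hmem

theorem statement18 (g h : ℂ → ℂ)
    (hg : DifferentiableOn ℂ g (ball (0 : ℂ) 1))
    (hh : DifferentiableOn ℂ h (ball (0 : ℂ) 1))
    (hgD : (∫⁻ z in ball (0 : ℂ) 1, (‖deriv g z‖₊ : ℝ≥0∞) ^ 2 ∂dA) < ⊤)
    (φ : ℂ → ℂ) (hφ : ∀ z, φ z = g z + conj (h z))
    (hbdd : ∃ M : ℝ, ∀ z ∈ ball (0 : ℂ) 1, ‖φ z‖ ≤ M) :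
    ∀ f : Polynomial ℂ, f.eval 0 = 0 → ∀ w ∈ ball (0 : ℂ) 1,
      HasDerivAt (toeplitz g φ (fun z => f.eval z))
        (deriv g w * f.eval w +
          ∫ z in ball (0 : ℂ) 1,
            φ z * deriv (fun x => f.eval x) z * ((1 - w * conj z) ^ 2)⁻¹ ∂dA)
        w := by
  intro f _ w hwb
  have hw : ‖w‖ < 1 := by simpa using hwb
  obtain ⟨M, hM⟩ := hbdd
  have hpi : ENNReal.ofReal (Real.pi)⁻¹ ≠ 0 := by
    simpa using Real.pi_pos
  have hdA : dA.restrict (ball (0 : ℂ) 1) =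
      ENNReal.ofReal (Real.pi)⁻¹ • (volume : Measure ℂ).restrict (ball (0 : ℂ) 1) := by
    rw [dA, Measure.restrict_smul]
  have hintA : ∀ u : ℂ → ℂ, ∫ z in ball (0 : ℂ) 1, u z ∂dA =
      (Real.pi : ℂ)⁻¹ * ∫ z in ball (0 : ℂ) 1, u z := by
    intro u
    rw [hdA, integral_smul_measure, ENNReal.toReal_ofReal (by positivity)]
    simp
  rw [hdA, lintegral_smul_measure] at hgD
  have hgD' : (∫⁻ z in ball (0 : ℂ) 1, ‖deriv g z‖ₑ ^ 2) < ⊤ := by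
    by_contra hcon
    rw [not_lt, top_le_iff] at hcon
    have : (∫⁻ z in ball (0 : ℂ) 1, (‖deriv g z‖₊ : ℝ≥0∞) ^ 2) = ⊤ := hcon
    rw [this, smul_eq_mul, ENNReal.mul_top hpi] at hgD
    exact lt_irrefl _ hgD
  have hg' : DifferentiableOn ℂ (deriv g) (ball (0 : ℂ) 1) := hg.deriv isOpen_ball
  haveI : IsFiniteMeasure ((volume : Measure ℂ).restrict (ball (0 : ℂ) 1)) :=
    ⟨by rw [Measure.restrict_apply_univ]; exact measure_ball_lt_top⟩
  have hg'i : IntegrableOn (deriv g) (ball (0 : ℂ) 1) := by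
    refine MemLp.integrable (q := 2) (by norm_num)
      ⟨hg'.continuousOn.aestronglyMeasurable measurableSet_ball, ?_⟩
    rw [eLpNorm_lt_top_iff_lintegral_rpow_enorm_lt_top (by norm_num) (by norm_num)]
    simpa using hgD'
  have hbd : ∀ q : Polynomial ℂ, ∃ C : ℝ, ∀ z ∈ ball (0 : ℂ) 1, ‖q.eval z‖ ≤ C := by
    intro q
    obtain ⟨C, hC⟩ := (isCompact_closedBall (0 : ℂ) 1).exists_bound_of_continuousOn
      q.continuous.continuousOn
    exact ⟨C, fun z hz => hC z (ball_subset_closedBall hz)⟩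
  have hGi : IntegrableOn (fun z => deriv g z * f.eval z) (ball (0 : ℂ) 1) := by
    obtain ⟨C, hC⟩ := hbd f
    refine Integrable.mul_bdd (c := C) hg'i f.continuous.aestronglyMeasurable ?_
    filter_upwards [ae_restrict_mem measurableSet_ball] with z hz
    exact hC z hz
  have hφc : ContinuousOn φ (ball (0 : ℂ) 1) := by
    rw [show φ = fun z => g z + conj (h z) from funext hφ]
    exact hg.continuousOn.add (Complex.continuous_conj.comp_continuousOn hh.continuousOn)
  have hdf : ∀ z, deriv (fun x => f.eval x) z = f.derivative.eval z := fun z => f.deriv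
  have hPi : IntegrableOn (fun z => φ z * deriv (fun x => f.eval x) z) (ball (0 : ℂ) 1) := by
    simp_rw [hdf]
    obtain ⟨C, hC⟩ := hbd f.derivative
    refine Integrable.mul_bdd (c := C) ?_ f.derivative.continuous.aestronglyMeasurable ?_
    · refine Integrable.of_bound (hφc.aestronglyMeasurable measurableSet_ball) M ?_
      filter_upwards [ae_restrict_mem measurableSet_ball] with z hz
      exact hM z hz
    filter_upwards [ae_restrict_mem measurableSet_ball] with z hz
    exact hC z hz
  have hHi := hGi.add hPi
  have hrep := aux_repro (fun z => deriv g z * f.eval z)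
    (hg'.mul f.differentiable.differentiableOn) hGi w hw
  have hpi0 : (Real.pi : ℂ) ≠ 0 := by exact_mod_cast Real.pi_ne_zero
  -- rewrite the derivative as a single integral
  have hval : deriv g w * f.eval w + ∫ z in ball (0 : ℂ) 1,
      φ z * deriv (fun x => f.eval x) z * ((1 - w * conj z) ^ 2)⁻¹ ∂dA =
      (Real.pi : ℂ)⁻¹ * ∫ z in ball (0 : ℂ) 1,
        (deriv g z * f.eval z + φ z * deriv (fun x => f.eval x) z) *
          ((1 - w * conj z) ^ 2)⁻¹ := by
    simp_rw [add_mul]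
    rw [hintA, integral_add (aux_int hGi hw) (aux_int hPi hw), hrep]
    field_simp
  rw [hval]
  have hfun : toeplitz g φ (fun z => f.eval z) = fun w => (Real.pi : ℂ)⁻¹ *
      ∫ z in ball (0 : ℂ) 1, (deriv g z * f.eval z + φ z * deriv (fun x => f.eval x) z) *
        (w / (1 - w * conj z)) := by
    funext w
    rw [toeplitz, hintA]
  rw [hfun]
  refine HasDerivAt.const_mul _ ?_
  obtain ⟨ρ, hwρ, hρ⟩ := exists_between hw
  have hnb : ball (0 : ℂ) ρ ∈ nhds w := isOpen_ball.mem_nhds (by simpa using hwρ)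
  have hkc : ∀ x : ℂ, ‖x‖ < 1 → ContinuousOn (fun z => x / (1 - x * conj z)) (ball (0 : ℂ) 1) := by
    intro x hx
    refine ContinuousOn.div continuousOn_const ?_ fun z hz => aux_ne0 hx hz
    exact (continuous_const.sub (continuous_const.mul Complex.continuous_conj)).continuousOn
  refine (hasDerivAt_integral_of_dominated_loc_of_deriv_le
    (F := fun x z => (deriv g z * f.eval z + φ z * deriv (fun x => f.eval x) z) *
        (x / (1 - x * conj z)))
    (F' := fun x z => (deriv g z * f.eval z + φ z * deriv (fun x => f.eval x) z) *
        ((1 - x * conj z) ^ 2)⁻¹)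
    (bound := fun z => ‖deriv g z * f.eval z + φ z * deriv (fun x => f.eval x) z‖ *
      ((1 - ρ) ^ 2)⁻¹) hnb ?_ ?_ ?_ ?_ ?_ ?_).2
  · filter_upwards [hnb] with x hx
    have hx : ‖x‖ < ρ := by simpa using hx
    exact hHi.aestronglyMeasurable.mul
      ((hkc x (hx.trans hρ)).aestronglyMeasurable measurableSet_ball)
  · refine Integrable.mul_bdd (c := ‖w‖ / (1 - ‖w‖)) hHi
      ((hkc w hw).aestronglyMeasurable measurableSet_ball) ?_
    filter_upwards [ae_restrict_mem measurableSet_ball] with z hz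
    rw [norm_div]
    have := aux_ne le_rfl hz (w := w)
    have : 0 < 1 - ‖w‖ := by linarith
    gcongr
  · exact hHi.aestronglyMeasurable.mul ((aux_contK hw).aestronglyMeasurable measurableSet_ball)
  · filter_upwards [ae_restrict_mem measurableSet_ball] with z hz x hx
    have hx : ‖x‖ < ρ := by simpa using hx
    rw [norm_mul]
    exact mul_le_mul_of_nonneg_left (aux_normK hρ hx.le hz) (norm_nonneg _)
  · exact hHi.norm.mul_const _
  · filter_upwards [ae_restrict_mem measurableSet_ball] with z hz x hx
    have hx : ‖x‖ < ρ := by simpa using hx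
    have hne := aux_ne0 (hx.trans hρ) hz
    refine HasDerivAt.const_mul _ ?_
    have := (hasDerivAt_id' x).div (((hasDerivAt_id' x).mul_const (conj z)).const_sub 1) hne
    refine this.congr_deriv ?_
    field_simp
    ring
end

section
/- Zero product property: let m ≥ 1 and let T₁, …, T_m be bounded operators on H such that each Tᵢ has Toeplitz matrix with coefficient sequence c⁽ⁱ⁾ : ℤ → ℂ. Then the composition T₁∘T₂∘⋯∘T_m is the zero operator if and only if there exists an index i ∈ {1, …, m} with c⁽ⁱ⁾(k) = 0 for all k ∈ ℤ (equivalently, Tᵢ = 0 for some i). -/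
open scoped ComplexConjugate

local notation "⟪" x ", " y "⟫" => @inner ℂ _ _ x y

namespace ZP

open MeasureTheory Filter Topology AddCircle

section Main

abbrev TT := UnitAddCircle
noncomputable abbrev mu : Measure TT := haarAddCircle

lemma fourier_norm_one (n : ℤ) (x : TT) : ‖fourier n x‖ = 1 := by
  rw [fourier_apply, Circle.norm_coe]

lemma fourier_ne_zero (n : ℤ) (x : TT) : fourier n x ≠ 0 := by
  intro h
  have := fourier_norm_one n x
  rw [h] at this; simp at this

lemma fourier_meas (n : ℤ) : AEStronglyMeasurable (fun x : TT => fourier n x) mu :=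
  (map_continuous (fourier n)).aestronglyMeasurable

lemma ae_zero_of_continuous (h : TT → ℂ) (hi : Integrable h mu)
    (hc : ∀ f : C(TT, ℂ), ∫ x, f x * h x ∂mu = 0) : h =ᵐ[mu] 0 := by
  apply ae_eq_zero_of_forall_setIntegral_isClosed_eq_zero hi
  intro s hs
  have hpos : ∀ n : ℕ, (0:ℝ) < 1 / ((n : ℝ) + 1) := fun n => by positivity
  have hlim : Tendsto (fun n : ℕ => 1 / ((n : ℝ) + 1)) atTop (𝓝 0) :=
    tendsto_one_div_add_atTop_nhds_zero_nat
  have key := thickenedIndicator_tendsto_indicator_closure hpos hlim s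
  rw [hs.closure_eq] at key
  have h1 : Tendsto (fun n : ℕ => ∫ x, (((thickenedIndicator (hpos n) s x : NNReal) : ℝ) : ℂ) * h x ∂mu)
      atTop (𝓝 (∫ x, s.indicator h x ∂mu)) := by
    apply tendsto_integral_of_dominated_convergence (fun x => ‖h x‖)
    · intro n
      apply AEStronglyMeasurable.mul _ hi.1
      apply Continuous.aestronglyMeasurable
      have := (thickenedIndicator (hpos n) s).continuous
      fun_prop
    · exact hi.norm
    · intro n
      apply ae_of_all
      intro x
      rw [norm_mul]
      have := thickenedIndicator_le_one (hpos n) s x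
      have h2 : ‖(((thickenedIndicator (hpos n) s x : NNReal) : ℝ) : ℂ)‖ ≤ 1 := by
        rw [Complex.norm_real]
        simpa using this
      nlinarith [norm_nonneg (h x)]
    · apply ae_of_all
      intro x
      have hx := (tendsto_pi_nhds.1 key) x
      have hx2 : Tendsto (fun n : ℕ => (((thickenedIndicator (hpos n) s x : NNReal) : ℝ) : ℂ) * h x)
          atTop (𝓝 ((((s.indicator (fun _ => (1 : NNReal)) x : NNReal) : ℝ) : ℂ) * h x)) := by
        apply Tendsto.mul_const
        exact (Complex.continuous_ofReal.tendsto _).comp ((NNReal.continuous_coe.tendsto _).comp hx)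
      convert hx2 using 2
      by_cases hxs : x ∈ s <;> simp [hxs]
  rw [integral_indicator hs.measurableSet] at h1
  have h0 : (fun n : ℕ => ∫ x, (((thickenedIndicator (hpos n) s x : NNReal) : ℝ) : ℂ) * h x ∂mu) = fun _ => 0 := by
    funext n
    have := hc ⟨fun x => (((thickenedIndicator (hpos n) s x : NNReal) : ℝ) : ℂ), by
      have := (thickenedIndicator (hpos n) s).continuous
      fun_prop⟩
    exact this
  rw [h0] at h1
  exact (tendsto_nhds_unique h1 tendsto_const_nhds)

lemma integrable_cont_mul (f : C(TT, ℂ)) {h : TT → ℂ} (hi : Integrable h mu) :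
    Integrable (fun x => f x * h x) mu := by
  refine hi.bdd_mul (c := ‖f‖) (map_continuous f).aestronglyMeasurable ?_
  exact ae_of_all _ (fun x => f.norm_coe_le_norm x)

lemma ae_zero_of_fourier (h : TT → ℂ) (hi : Integrable h mu)
    (hc : ∀ n : ℤ, ∫ x, fourier n x * h x ∂mu = 0) : h =ᵐ[mu] 0 := by
  apply ae_zero_of_continuous h hi
  let Φ : C(TT, ℂ) →ₗ[ℂ] ℂ :=
    { toFun := fun f => ∫ x, f x * h x ∂mu
      map_add' := by
        intro f g
        simp only [ContinuousMap.add_apply, add_mul]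
        exact integral_add (integrable_cont_mul f hi) (integrable_cont_mul g hi)
      map_smul' := by
        intro c f
        simp only [ContinuousMap.smul_apply, smul_eq_mul, mul_assoc, RingHom.id_apply]
        exact integral_const_mul _ _ }
  let Ψ : C(TT, ℂ) →L[ℂ] ℂ := Φ.mkContinuous (∫ x, ‖h x‖ ∂mu) (by
    intro f
    change ‖∫ x, f x * h x ∂mu‖ ≤ _
    calc ‖∫ x, f x * h x ∂mu‖ ≤ ∫ x, ‖f‖ * ‖h x‖ ∂mu := by
          apply norm_integral_le_of_norm_le (hi.norm.const_mul _)
          apply ae_of_all; intro x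
          rw [norm_mul]
          gcongr
          exact f.norm_coe_le_norm x
      _ = _ := by rw [integral_const_mul, mul_comm])
  have hker : (Submodule.span ℂ (Set.range (@fourier 1))).topologicalClosure ≤ LinearMap.ker Ψ.toLinearMap := by
    apply Submodule.topologicalClosure_minimal
    · rw [Submodule.span_le]
      rintro _ ⟨n, rfl⟩
      exact hc n
    · exact Ψ.isClosed_ker
  rw [span_fourier_closure_eq_top] at hker
  intro f
  exact hker (Submodule.mem_top (x := f))

lemma memLp_fourier_mul {f : TT → ℂ} (n : ℤ) {p : ENNReal} (hf : MemLp f p mu) :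
    MemLp (fun x => fourier n x * f x) p mu := by
  refine hf.of_le ((fourier_meas n).mul hf.1) (ae_of_all _ fun x => ?_)
  rw [norm_mul, fourier_norm_one, one_mul]

lemma memLp_conj {f : TT → ℂ} {p : ENNReal} (hf : MemLp f p mu) :
    MemLp (fun x => conj (f x)) p mu := by
  refine hf.of_le (Complex.continuous_conj.comp_aestronglyMeasurable hf.1) (ae_of_all _ fun x => ?_)
  simp

lemma integrable_mul2 {f g : TT → ℂ} (hf : MemLp f 2 mu) (hg : MemLp g 2 mu) :
    Integrable (fun x => f x * g x) mu := MemLp.integrable_mul hf hg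

lemma inner_toLp {f g : TT → ℂ} (hf : MemLp f 2 mu) (hg : MemLp g 2 mu) :
    inner ℂ (hf.toLp f) (hg.toLp g) = ∫ x, g x * conj (f x) ∂mu := by
  rw [L2.inner_def]
  apply integral_congr_ae
  filter_upwards [hf.coeFn_toLp, hg.coeFn_toLp] with x h1 h2
  rw [h1, h2]; simp

lemma int_fourier {n : ℤ} (hn : n ≠ 0) : ∫ x : TT, fourier n x ∂mu = 0 := by
  have := congrFun (@fourierCoeff_fourier 1 _ n) 0
  simpa [fourierCoeff, hn.symm, -fourier_apply, fourier_zero] using this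

lemma szego (F : TT → ℂ) (hF : MemLp F 2 mu) : ∃ G : TT → ℂ, MemLp G 2 mu ∧
    (∃ c : ℝ, ∀ᵐ x ∂mu, ‖G x‖ ^ 2 = c) ∧
    ∀ u : TT → ℂ, MemLp u 2 mu →
      (∀ k : ℕ, ∫ x, fourier ((k : ℤ) + 1) x * F x * conj (u x) ∂mu = 0) →
      ∫ x, G x * conj (u x) ∂mu = ∫ x, F x * conj (u x) ∂mu := by
  let s : ℕ → Lp ℂ 2 mu := fun k => (memLp_fourier_mul ((k : ℤ) + 1) hF).toLp _
  let K : Submodule ℂ (Lp ℂ 2 mu) := (Submodule.span ℂ (Set.range s)).topologicalClosure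
  have : CompleteSpace K := (Submodule.isClosed_topologicalClosure _).completeSpace_coe
  let f0 := hF.toLp F
  let g : Lp ℂ 2 mu := f0 - K.starProjection f0
  have hg : g ∈ Kᗮ := Submodule.sub_starProjection_mem_orthogonal f0
  have hgm : MemLp g 2 mu := Lp.memLp g
  have hgL : hgm.toLp g = g := Lp.toLp_coeFn g hgm
  have P : ∀ k : ℕ, ∫ x, fourier ((k : ℤ) + 1) x * F x * conj (g x) ∂mu = 0 := by
    intro k
    have h1 : s k ∈ K := Submodule.le_topologicalClosure _ (Submodule.subset_span ⟨k, rfl⟩)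
    have h2 := (Submodule.mem_orthogonal' K g).1 hg (s k) h1
    rw [← hgL, inner_toLp] at h2
    exact h2
  have Q : ∀ u : TT → ℂ, MemLp u 2 mu →
      (∀ k : ℕ, ∫ x, fourier ((k : ℤ) + 1) x * F x * conj (u x) ∂mu = 0) →
      ∫ x, g x * conj (u x) ∂mu = ∫ x, F x * conj (u x) ∂mu := by
    intro u hu huk
    have h1 : K ≤ (ℂ ∙ hu.toLp u)ᗮ := by
      apply Submodule.topologicalClosure_minimal
      · rw [Submodule.span_le]
        rintro _ ⟨k, rfl⟩
        rw [SetLike.mem_coe, Submodule.mem_orthogonal_singleton_iff_inner_right, inner_toLp]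
        exact huk k
      · exact Submodule.isClosed_orthogonal _
    have h2 : inner ℂ (hu.toLp u) g = inner ℂ (hu.toLp u) f0 := by
      have h3 := h1 (K.starProjection_apply_mem f0)
      rw [Submodule.mem_orthogonal_singleton_iff_inner_right] at h3
      simp only [g, inner_sub_right, h3, sub_zero]
    rw [← hgL, inner_toLp, inner_toLp] at h2
    exact h2
  refine ⟨g, hgm, ?_, Q⟩
  have hInt : Integrable (fun x => g x * conj (g x)) mu := integrable_mul2 hgm (memLp_conj hgm)
  have hk : ∀ k : ℕ, ∫ x, fourier ((k : ℤ) + 1) x * (g x * conj (g x)) ∂mu = 0 := by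
    intro k
    have h1 := Q (fun x => fourier (-((k : ℤ) + 1)) x * g x) (memLp_fourier_mul _ hgm) (by
      intro j
      have := P (j + k + 1)
      rw [← this]
      congr 1; funext x
      rw [map_mul, fourier_neg, Complex.conj_conj]
      have : fourier (((j + k + 1 : ℕ) : ℤ) + 1) x = fourier ((j : ℤ) + 1) x * fourier ((k : ℤ) + 1) x := by
        rw [← fourier_add]; congr 1; push_cast; ring_nf
      rw [this]; ring)
    have h2 := P k
    simp only [map_mul, fourier_neg, Complex.conj_conj] at h1
    calc _ = ∫ x, g x * (fourier ((k : ℤ) + 1) x * conj (g x)) ∂mu := by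
          congr 1; funext x; ring
      _ = _ := h1
      _ = _ := by rw [← h2]; congr 1; funext x; ring
  have hk' : ∀ k : ℕ, ∫ x, fourier (-((k : ℤ) + 1)) x * (g x * conj (g x)) ∂mu = 0 := by
    intro k
    have := congrArg conj (hk k)
    rw [← integral_conj] at this
    rw [map_zero] at this
    rw [← this]
    congr 1; funext x
    rw [fourier_neg]; simp [mul_comm]
  set c : ℂ := ∫ x, g x * conj (g x) ∂mu with hc
  have hz := ae_zero_of_fourier (fun x => g x * conj (g x) - c) (hInt.sub (integrable_const _)) (by
    intro n
    have hI1 : Integrable (fun x => fourier n x * (g x * conj (g x))) mu := integrable_cont_mul _ hInt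
    have hI2 : Integrable (fun x : TT => fourier n x * c) mu := integrable_cont_mul (fourier n) (integrable_const c)
    simp only [mul_sub]
    rw [integral_sub hI1 hI2, integral_mul_const]
    have hfz : n ≠ 0 → ∫ x : TT, fourier n x ∂mu = 0 := int_fourier
    rcases lt_trichotomy n 0 with h | h | h
    · obtain ⟨k, rfl⟩ : ∃ k : ℕ, n = -((k : ℤ) + 1) := ⟨(-n - 1).toNat, by omega⟩
      rw [hk' k, hfz (by omega)]; simp
    · subst h; simp [hc]
    · obtain ⟨k, rfl⟩ : ∃ k : ℕ, n = ((k : ℤ) + 1) := ⟨(n - 1).toNat, by omega⟩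
      rw [hk k, hfz (by omega)]; simp)
  refine ⟨c.re, ?_⟩
  filter_upwards [hz] with x hx
  have h1 : g x * conj (g x) = c := by simpa [sub_eq_zero] using hx
  rw [← h1, Complex.mul_conj]
  rw [Complex.ofReal_re, Complex.normSq_eq_norm_sq]

/-- Fourier coefficients. -/
noncomputable def cf (f : TT → ℂ) (n : ℤ) : ℂ := ∫ x, fourier (-n) x * f x ∂mu

lemma cf_eq (f : TT → ℂ) (n : ℤ) : cf f n = fourierCoeff f n := rfl

lemma mem_int {f : TT → ℂ} (hf : MemLp f 2 mu) : Integrable f mu :=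
  hf.integrable (by norm_num)

lemma cf_add {f g : TT → ℂ} (hf : Integrable f mu) (hg : Integrable g mu) (n : ℤ) :
    cf (f + g) n = cf f n + cf g n := by
  simp only [cf, Pi.add_apply, mul_add]
  exact integral_add (integrable_cont_mul _ hf) (integrable_cont_mul _ hg)

lemma cf_sub {f g : TT → ℂ} (hf : Integrable f mu) (hg : Integrable g mu) (n : ℤ) :
    cf (f - g) n = cf f n - cf g n := by
  simp only [cf, Pi.sub_apply, mul_sub]
  exact integral_sub (integrable_cont_mul _ hf) (integrable_cont_mul _ hg)

lemma cf_smul (c : ℂ) (f : TT → ℂ) (n : ℤ) : cf (fun x => c * f x) n = c * cf f n := by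
  simp only [cf]
  rw [← integral_const_mul]
  congr 1; funext x; ring

lemma cf_congr {f g : TT → ℂ} (h : f =ᵐ[mu] g) (n : ℤ) : cf f n = cf g n := by
  apply integral_congr_ae
  filter_upwards [h] with x hx
  rw [hx]

lemma cf_conj (f : TT → ℂ) (n : ℤ) : cf (fun x => conj (f x)) n = conj (cf f (-n)) := by
  simp only [cf]
  rw [← integral_conj]
  congr 1; funext x
  rw [map_mul, neg_neg, fourier_neg]

lemma cf_fourier_mul (k : ℤ) (f : TT → ℂ) (n : ℤ) :
    cf (fun x => fourier k x * f x) n = cf f (n - k) := by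
  simp only [cf]
  congr 1; funext x
  rw [← mul_assoc, ← fourier_add]
  congr 3; ring

lemma cf_const (c : ℂ) (n : ℤ) : cf (fun _ => c) n = if n = 0 then c else 0 := by
  simp only [cf]
  rw [integral_mul_const]
  split_ifs with h
  · subst h; simp
  · rw [int_fourier (by omega)]; simp

lemma ae_eq_of_cf {f g : TT → ℂ} (hf : Integrable f mu) (hg : Integrable g mu)
    (h : ∀ n, cf f n = cf g n) : f =ᵐ[mu] g := by
  have := ae_zero_of_fourier (f - g) (hf.sub hg) (by
    intro n
    have h1 := cf_sub hf hg (-n)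
    rw [h, sub_self] at h1
    simpa only [cf, neg_neg] using h1)
  filter_upwards [this] with x hx
  simpa [sub_eq_zero] using hx

lemma cf_mul_hasSum {f g : TT → ℂ} (hf : MemLp f 2 mu) (hg : MemLp g 2 mu) (n : ℤ) :
    HasSum (fun k : ℤ => cf f (n - k) * cf g k) (cf (fun x => f x * g x) n) := by
  have hu : MemLp (fun x => conj (fourier (-n) x * f x)) 2 mu := memLp_conj (memLp_fourier_mul _ hf)
  have hb : ∀ k : ℤ, MemLp (fun x : TT => fourier k x) 2 mu := fun k =>
    (map_continuous (fourier k)).memLp_of_hasCompactSupport (HasCompactSupport.of_compactSpace _)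
  have hbe : ∀ k : ℤ, (fourierBasis (T := (1:ℝ))) k = (hb k).toLp _ := by
    intro k
    rw [coe_fourierBasis]
    apply Lp.ext
    refine (coeFn_fourierLp 2 k).trans (hb k).coeFn_toLp.symm
  have h := (fourierBasis (T := (1:ℝ))).hasSum_inner_mul_inner (hu.toLp _) (hg.toLp g)
  simp only [hbe, inner_toLp] at h
  have e1 : (fun k : ℤ => cf f (n - k) * cf g k) = (fun k : ℤ =>
      (∫ x, fourier k x * conj (conj (fourier (-n) x * f x)) ∂mu) *
        ∫ x, g x * conj (fourier k x) ∂mu) := by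
    funext k
    congr 1
    · simp only [cf]
      congr 1; funext x
      rw [Complex.conj_conj, ← mul_assoc, ← fourier_add]; congr 3; ring
    · simp only [cf]
      congr 1; funext x
      rw [fourier_neg, mul_comm]
  have e2 : cf (fun x => f x * g x) n =
      ∫ x, g x * conj (conj (fourier (-n) x * f x)) ∂mu := by
    simp only [cf]
    congr 1; funext x
    rw [Complex.conj_conj]; ring
  rw [e1, e2]
  exact h

lemma realize {a : ℤ → ℂ} (ha : Summable fun n => ‖a n‖ ^ 2) :
    ∃ f : TT → ℂ, MemLp f 2 mu ∧ ∀ n, cf f n = a n := by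
  have hm : Memℓp a 2 := by
    apply memℓp_gen
    simpa using ha
  let f := (fourierBasis (T := (1:ℝ))).repr.symm ⟨a, hm⟩
  refine ⟨f, Lp.memLp f, fun n => ?_⟩
  rw [cf_eq, ← fourierBasis_repr]
  simp [f]

lemma memLp_of_cf {f : TT → ℂ} (hf : Integrable f mu) (h : Summable fun n => ‖cf f n‖ ^ 2) :
    MemLp f 2 mu := by
  obtain ⟨g, hg, hgc⟩ := realize h
  exact (memLp_congr_ae (ae_eq_of_cf hf (mem_int hg) fun n => (hgc n).symm)).2 hg

lemma cf_mul_low {f g : TT → ℂ} (hf : MemLp f 2 mu) (hg : MemLp g 2 mu) (a b : ℤ)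
    (ha : ∀ n < a, cf f n = 0) (hb : ∀ n < b, cf g n = 0) :
    ∀ n < a + b, cf (fun x => f x * g x) n = 0 := by
  intro n hn
  refine (cf_mul_hasSum hf hg n).unique ?_
  convert hasSum_zero using 1
  funext k
  by_cases hk : k < b
  · rw [hb k hk, mul_zero]
  · rw [ha _ (by omega), zero_mul]

lemma cf_mul_high {f g : TT → ℂ} (hf : MemLp f 2 mu) (hg : MemLp g 2 mu) (a b : ℤ)
    (ha : ∀ n > a, cf f n = 0) (hb : ∀ n > b, cf g n = 0) :
    ∀ n > a + b, cf (fun x => f x * g x) n = 0 := by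
  intro n hn
  refine (cf_mul_hasSum hf hg n).unique ?_
  convert hasSum_zero using 1
  funext k
  by_cases hk : k > b
  · rw [hb k hk, mul_zero]
  · rw [ha _ (by omega), zero_mul]

/-- Hardy class `H²`. -/
def IsAn (f : TT → ℂ) : Prop := MemLp f 2 mu ∧ ∀ n < 0, cf f n = 0

lemma an_dichotomy {f : TT → ℂ} (hf : IsAn f) : f =ᵐ[mu] 0 ∨ ∀ᵐ x ∂mu, f x ≠ 0 := by
  by_cases h0 : ∀ n : ℕ, cf f n = 0
  · left
    have := ae_eq_of_cf (mem_int hf.1) (integrable_const (0:ℂ)) (fun n => by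
      rw [cf_const]
      rcases lt_or_ge n 0 with h | h
      · rw [hf.2 n h]; simp
      · obtain ⟨k, rfl⟩ := Int.eq_ofNat_of_zero_le h
        rw [h0]; simp)
    exact this
  right
  push Not at h0
  classical
  let N := Nat.find h0
  have hN : cf f N ≠ 0 := Nat.find_spec h0
  have hlt : ∀ n : ℤ, n < N → cf f n = 0 := by
    intro n hn
    rcases lt_or_ge n 0 with h | h
    · exact hf.2 n h
    · obtain ⟨k, rfl⟩ := Int.eq_ofNat_of_zero_le h
      by_contra hk
      exact Nat.find_min h0 (by exact_mod_cast hn) hk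
  let h : TT → ℂ := fun x => fourier (-(N : ℤ)) x * f x
  have hh : MemLp h 2 mu := memLp_fourier_mul _ hf.1
  obtain ⟨G, hG, ⟨c, hc⟩, hu⟩ := szego h hh
  have h1 := hu (fun _ => 1) (memLp_const _) (by
    intro k
    have : cf h (-((k : ℤ) + 1)) = 0 := by
      simp only [h]
      rw [cf_fourier_mul]; apply hlt; omega
    simpa only [cf, neg_neg, map_one, mul_one] using this)
  simp only [map_one, mul_one] at h1
  have hInt : ∫ x, G x ∂mu ≠ 0 := by
    rw [h1]; exact hN
  have hG0 : ¬ (G =ᵐ[mu] 0) := by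
    intro h; apply hInt
    rw [integral_congr_ae h]; simp
  have hcne : c ≠ 0 := by
    rintro rfl
    apply hG0
    filter_upwards [hc] with x hx
    simpa using hx
  obtain ⟨f', hf'm, hf'⟩ := hf.1.1
  let E : Set TT := {x | f' x = 0}
  have hE : MeasurableSet E := hf'm.measurable (measurableSet_singleton 0)
  have h2 := hu (E.indicator G) (hG.indicator hE) (by
    intro k
    rw [integral_congr_ae (g := fun _ => 0)]
    · simp
    filter_upwards [hf'] with x hx
    by_cases hxE : x ∈ E
    · have : f x = 0 := by rw [hx]; exact hxE
      simp [h, this]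
    · simp [hxE])
  have h3 : ∫ x, h x * conj (E.indicator G x) ∂mu = 0 := by
    rw [integral_congr_ae (g := fun _ => 0)]
    · simp
    filter_upwards [hf'] with x hx
    by_cases hxE : x ∈ E
    · have : f x = 0 := by rw [hx]; exact hxE
      simp [h, this]
    · simp [hxE]
  rw [h3] at h2
  have h4 : ∫ x, G x * conj (E.indicator G x) ∂mu = ∫ x, E.indicator (fun _ => (c:ℂ)) x ∂mu := by
    apply integral_congr_ae
    filter_upwards [hc] with x hx
    by_cases hxE : x ∈ E
    · simp only [hxE, Set.indicator_of_mem]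
      rw [Complex.mul_conj, Complex.normSq_eq_norm_sq, hx]
    · simp [hxE]
  rw [h4, integral_indicator hE, setIntegral_const] at h2
  have h5 : mu.real E = 0 := by
    have : (mu.real E : ℂ) * c = 0 := by simpa using h2
    rcases mul_eq_zero.1 this with h | h
    · exact_mod_cast h
    · exact absurd (by exact_mod_cast h) hcne
  have h6 : mu E = 0 := by
    rwa [measureReal_eq_zero_iff] at h5
  have h7 : ∀ᵐ x ∂mu, x ∉ E := by
    rw [ae_iff]; simpa using h6
  filter_upwards [h7, hf'] with x hx hx2
  rw [hx2]; exact hx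

lemma memLp_of_bdd {f : TT → ℂ} (hm : AEStronglyMeasurable f mu) (C : ℝ)
    (h : ∀ᵐ x ∂mu, ‖f x‖ ≤ C) : MemLp f 2 mu := MemLp.of_bound hm C h

lemma conj_four (j : ℤ) (x : TT) : conj (fourier (-j) x) = fourier j x := by
  rw [fourier_neg, Complex.conj_conj]

lemma exists_multiplier {f : TT → ℂ} (hf : IsAn f) : ∃ g : TT → ℂ, IsAn g ∧
    (∃ C : ℝ, ∀ᵐ x ∂mu, ‖g x‖ ≤ C) ∧ (∀ᵐ x ∂mu, g x ≠ 0) ∧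
    IsAn (fun x => g x * f x) ∧ (∃ C : ℝ, ∀ᵐ x ∂mu, ‖g x * f x‖ ≤ C) := by
  let F : TT → ℂ := fun x => ((1 + ‖f x‖ : ℝ) : ℂ)
  have hFpos : ∀ x, 0 < 1 + ‖f x‖ := fun x => by positivity
  have hF0 : ∀ x, F x ≠ 0 := fun x => by
    simp only [F]; exact_mod_cast (hFpos x).ne'
  have hFn : ∀ x, ‖F x‖ = 1 + ‖f x‖ := fun x => by
    simp only [F]; rw [Complex.norm_real, Real.norm_of_nonneg (hFpos x).le]
  have hFc : ∀ x, conj (F x) = F x := fun x => Complex.conj_ofReal _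
  have hFm : MemLp F 2 mu := by
    have h1 : MemLp (fun x => ‖f x‖) 2 mu := hf.1.norm
    have h2 : MemLp (fun _ : TT => (1 : ℝ)) 2 mu := memLp_const 1
    have h3 : MemLp (fun x => 1 + ‖f x‖) 2 mu := h2.add h1
    refine h3.of_le (Complex.continuous_ofReal.comp_aestronglyMeasurable h3.1) (ae_of_all _ fun x => ?_)
    rw [Complex.norm_real]
  obtain ⟨G, hG, ⟨c, hc⟩, hu⟩ := szego F hFm
  have hFi : AEStronglyMeasurable (fun x => (F x)⁻¹) mu := (hFm.1.aemeasurable.inv).aestronglyMeasurable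
  let g : TT → ℂ := fun x => G x * (F x)⁻¹
  have hgm : AEStronglyMeasurable g mu := hG.1.mul hFi
  have hle1 : ∀ x, ‖(F x)⁻¹‖ ≤ 1 := fun x => by
    rw [norm_inv, hFn]; apply inv_le_one_of_one_le₀; linarith [norm_nonneg (f x)]
  have hle2 : ∀ x, ‖f x * (F x)⁻¹‖ ≤ 1 := fun x => by
    rw [norm_mul, norm_inv, hFn, ← div_eq_mul_inv, div_le_one (hFpos x)]; linarith
  have hGb : ∀ᵐ x ∂mu, ‖G x‖ ≤ Real.sqrt c := by
    filter_upwards [hc] with x hx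
    rw [← hx, Real.sqrt_sq (norm_nonneg _)]
  have hgb : ∀ᵐ x ∂mu, ‖g x‖ ≤ Real.sqrt c := by
    filter_upwards [hGb] with x hx
    simp only [g]; rw [norm_mul]
    calc _ ≤ Real.sqrt c * 1 := by gcongr; exact hle1 x
      _ = _ := mul_one _
  have hgfb : ∀ᵐ x ∂mu, ‖g x * f x‖ ≤ Real.sqrt c := by
    filter_upwards [hGb] with x hx
    have : g x * f x = G x * (f x * (F x)⁻¹) := by simp only [g]; ring
    rw [this, norm_mul]
    calc _ ≤ Real.sqrt c * 1 := by gcongr; exact hle2 x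
      _ = _ := mul_one _
  have hfour : ∀ j : ℤ, MemLp (fun x : TT => fourier j x) 2 mu := fun j =>
    memLp_of_bdd (fourier_meas j) 1 (ae_of_all _ fun x => (fourier_norm_one j x).le)
  have hA : ∀ j : ℕ, cf g (-(j : ℤ)) = cf (fun _ => 1) (-(j : ℤ)) := by
    intro j
    have := hu (fun x => fourier (-(j : ℤ)) x * (F x)⁻¹)
      (memLp_fourier_mul _ (memLp_of_bdd hFi 1 (ae_of_all _ hle1))) (by
        intro k
        have h0 := int_fourier (n := (k : ℤ) + 1 + j) (by omega)
        rw [← h0]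
        congr 1; funext x
        rw [fourier_add (m := (k : ℤ) + 1) (n := (j : ℤ))]
        simp only [map_mul, conj_four, map_inv₀, hFc]
        have := hF0 x
        generalize F x = w at *
        field_simp)
    calc cf g (-(j : ℤ)) = ∫ x, G x * conj (fourier (-(j : ℤ)) x * (F x)⁻¹) ∂mu := by
          simp only [cf]; congr 1; funext x
          simp only [map_mul, conj_four, map_inv₀, hFc, neg_neg]
          simp only [g]; ring
      _ = _ := this
      _ = _ := by
          simp only [cf]; congr 1; funext x
          simp only [map_mul, conj_four, map_inv₀, hFc, neg_neg]
          have := hF0 x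
          generalize F x = w at *
          field_simp
  have hB : ∀ j : ℕ, cf (fun x => g x * f x) (-((j : ℤ) + 1)) = 0 := by
    intro j
    have := hu (fun x => fourier (-((j : ℤ) + 1)) x * (conj (f x) * (F x)⁻¹))
      (memLp_fourier_mul _ (memLp_of_bdd ((memLp_conj hf.1).1.mul hFi) 1
        (ae_of_all _ fun x => by
          have := hle2 x
          rw [norm_mul] at this
          rw [norm_mul, RCLike.norm_conj]
          exact this))) (by
        intro k
        have h0 := hf.2 (-((k : ℤ) + 1 + ((j : ℤ) + 1))) (by omega)
        rw [← h0]
        simp only [cf]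
        congr 1; funext x
        rw [neg_neg, fourier_add (m := (k : ℤ) + 1) (n := (j : ℤ) + 1)]
        simp only [map_mul, conj_four, map_inv₀, hFc, Complex.conj_conj]
        have := hF0 x
        generalize F x = w at *
        field_simp)
    have h0 := hf.2 (-((j : ℤ) + 1)) (by omega)
    rw [← h0]
    calc cf (fun x => g x * f x) (-((j : ℤ) + 1)) = ∫ x, G x * conj (fourier (-((j : ℤ) + 1)) x * (conj (f x) * (F x)⁻¹)) ∂mu := by
          simp only [cf]; congr 1; funext x
          simp only [map_mul, conj_four, map_inv₀, hFc, neg_neg, Complex.conj_conj]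
          simp only [g]; ring
      _ = _ := this
      _ = _ := by
          simp only [cf]; congr 1; funext x
          simp only [map_mul, conj_four, map_inv₀, hFc, neg_neg, Complex.conj_conj]
          have := hF0 x
          generalize F x = w at *
          field_simp
  have hgL := memLp_of_bdd hgm _ hgb
  have hgAn : IsAn g := ⟨hgL, by
    intro n hn
    obtain ⟨k, rfl⟩ : ∃ k : ℕ, n = -(k : ℤ) := ⟨(-n).toNat, by omega⟩
    rw [hA k, cf_const, if_neg (by omega)]⟩
  refine ⟨g, hgAn, ⟨_, hgb⟩, ?_, ⟨memLp_of_bdd (hgm.mul hf.1.1) _ hgfb, ?_⟩, ⟨_, hgfb⟩⟩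
  · rcases an_dichotomy hgAn with h | h
    · exfalso
      have h1 := hA 0
      rw [cf_congr h, cf_const] at h1
      have h2 := cf_const 0 0
      simp only [Nat.cast_zero, neg_zero, if_true] at h1 h2
      have h3 : cf (0 : TT → ℂ) 0 = 0 := h2
      rw [h3] at h1; exact zero_ne_one h1
    · exact h
  · intro n hn
    obtain ⟨k, rfl⟩ : ∃ k : ℕ, n = -((k : ℤ) + 1) := ⟨(-n - 1).toNat, by omega⟩
    exact hB k

/-- The algebra `H^∞` of bounded analytic functions. -/
def HI : Subring (TT → ℂ) where
  carrier := {f | AEStronglyMeasurable f mu ∧ (∃ C : ℝ, ∀ᵐ x ∂mu, ‖f x‖ ≤ C) ∧ ∀ n < 0, cf f n = 0}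
  mul_mem' := by
    rintro f g ⟨hf, ⟨C, hC⟩, hf0⟩ ⟨hg, ⟨D, hD⟩, hg0⟩
    refine ⟨hf.mul hg, ⟨C * D, ?_⟩, ?_⟩
    · filter_upwards [hC, hD] with x h1 h2
      rw [Pi.mul_apply, norm_mul]
      gcongr
      exact (norm_nonneg _).trans h1
    · exact cf_mul_low (memLp_of_bdd hf C hC) (memLp_of_bdd hg D hD) 0 0 hf0 hg0
  one_mem' := ⟨aestronglyMeasurable_const, ⟨1, ae_of_all _ fun x => by simp⟩, fun n hn => by
    have := cf_const 1 n
    rw [if_neg hn.ne] at this; exact this⟩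
  add_mem' := by
    rintro f g ⟨hf, ⟨C, hC⟩, hf0⟩ ⟨hg, ⟨D, hD⟩, hg0⟩
    refine ⟨hf.add hg, ⟨C + D, ?_⟩, ?_⟩
    · filter_upwards [hC, hD] with x h1 h2
      exact (norm_add_le _ _).trans (add_le_add h1 h2)
    · intro n hn
      rw [cf_add (mem_int (memLp_of_bdd hf C hC)) (mem_int (memLp_of_bdd hg D hD)), hf0 n hn, hg0 n hn, add_zero]
  zero_mem' := ⟨aestronglyMeasurable_const, ⟨0, ae_of_all _ fun x => by simp⟩, fun n hn => by
    have := cf_const 0 n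
    rw [if_neg hn.ne] at this; exact this⟩
  neg_mem' := by
    rintro f ⟨hf, ⟨C, hC⟩, hf0⟩
    refine ⟨hf.neg, ⟨C, ?_⟩, ?_⟩
    · filter_upwards [hC] with x h1
      simpa using h1
    · intro n hn
      have := cf_smul (-1) f n
      rw [hf0 n hn, mul_zero] at this
      rw [← this]; congr 1; funext x; simp

/-- conjugates -/
noncomputable def HIm : Subring (TT → ℂ) := HI.comap (starRingEnd (TT → ℂ))

/-- All members vanish a.e. or almost nowhere -/
def Dich (R : Subring (TT → ℂ)) : Prop := ∀ f ∈ R, f =ᵐ[mu] 0 ∨ ∀ᵐ x ∂mu, f x ≠ 0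

lemma dich_HI : Dich HI := by
  rintro f ⟨hf, ⟨C, hC⟩, hf0⟩
  exact an_dichotomy ⟨memLp_of_bdd hf C hC, hf0⟩

lemma dich_HIm : Dich HIm := by
  intro f hf
  have : starRingEnd (TT → ℂ) f ∈ HI := hf
  rcases dich_HI _ this with h | h
  · left
    filter_upwards [h] with x hx
    simpa using hx
  · right
    filter_upwards [h] with x hx
    simpa using hx

lemma exists_rows {ι κ : Type*} [Fintype ι] [Fintype κ] (A : Matrix ι κ ℂ) (r : ℕ)
    (h : A.rank = r) : ∃ f : Fin r → ι, LinearIndependent ℂ (A.submatrix f id).row := by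
  rw [Matrix.rank_eq_finrank_span_row] at h
  subst h
  obtain ⟨F, hF, -, hli⟩ := Submodule.exists_fun_fin_finrank_span_eq ℂ (Set.range A.row)
  choose f hf using hF
  refine ⟨f, ?_⟩
  have : (A.submatrix f id).row = F := by
    funext i; rw [← hf i]; rfl
  rw [this]; exact hli

lemma exists_minor {ι κ : Type*} [Fintype ι] [Fintype κ] (A : Matrix ι κ ℂ) (r : ℕ)
    (h : A.rank = r) : ∃ (f : Fin r → ι) (g : Fin r → κ), (A.submatrix f g).det ≠ 0 := by
  obtain ⟨f, hf⟩ := exists_rows A r h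
  have h1 := hf.rank_matrix
  rw [Fintype.card_fin] at h1
  obtain ⟨g, hg⟩ := exists_rows (A.submatrix f id).transpose r (by rw [Matrix.rank_transpose, h1])
  refine ⟨f, g, ?_⟩
  rw [Matrix.linearIndependent_rows_iff_isUnit, Matrix.isUnit_iff_isUnit_det] at hg
  rw [← Matrix.det_transpose]
  exact hg.ne_zero

lemma le_rank_iff {ι κ : Type*} [Fintype ι] [Fintype κ] (A : Matrix ι κ ℂ) (r : ℕ) :
    A.rank = r ↔ (∃ (f : Fin r → ι) (g : Fin r → κ), (A.submatrix f g).det ≠ 0) ∧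
      ∀ s, s > r → ∀ (f : Fin s → ι) (g : Fin s → κ), (A.submatrix f g).det = 0 := by
  have key : ∀ s (f : Fin s → ι) (g : Fin s → κ), (A.submatrix f g).det ≠ 0 → s ≤ A.rank := by
    intro s f g h
    have := Matrix.rank_submatrix_le A f g
    rwa [Matrix.rank_of_det_ne_zero h, Fintype.card_fin] at this
  constructor
  · intro h
    refine ⟨exists_minor A r h, fun s hs f g => ?_⟩
    by_contra hne
    have := key s f g hne
    omega
  · rintro ⟨⟨f, g, h1⟩, h2⟩
    have h3 := key r f g h1
    by_contra hne
    obtain ⟨f', g', h4⟩ := exists_minor A A.rank rfl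
    exact h4 (h2 _ (by omega) f' g')

/-- evaluation of a matrix of functions -/
def ev {ι κ : Type*} (Z : ι → κ → TT → ℂ) (x : TT) : Matrix ι κ ℂ := Matrix.of fun i j => Z i j x

lemma det_ev {r : ℕ} (Z : Fin r → Fin r → TT → ℂ) (x : TT) :
    (ev Z x).det = (Matrix.of Z).det x := by
  have := RingHom.map_det (Pi.evalRingHom (fun _ : TT => ℂ) x) (Matrix.of Z)
  exact this.symm

lemma det_mem {r : ℕ} (R : Subring (TT → ℂ)) (Z : Fin r → Fin r → TT → ℂ) (h : ∀ i j, Z i j ∈ R) :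
    (Matrix.of Z).det ∈ R := by
  rw [Matrix.det_apply]
  refine R.sum_mem fun σ _ => ?_
  rw [Units.smul_def]
  exact R.zsmul_mem (R.prod_mem fun i _ => h _ _) _

lemma rank_const {ι κ : Type*} [Fintype ι] [Fintype κ] (R : Subring (TT → ℂ)) (hR : Dich R)
    (Z : ι → κ → TT → ℂ) (h : ∀ i j, Z i j ∈ R) : ∃ r, ∀ᵐ x ∂mu, (ev Z x).rank = r := by
  have h1 : ∀ᵐ x ∂mu, ∀ (r : ℕ) (f : Fin r → ι) (g : Fin r → κ),
      (((ev Z x).submatrix f g).det = 0 ↔ (Matrix.of fun i j => Z (f i) (g j)).det =ᵐ[mu] 0) := by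
    rw [ae_all_iff]; intro r
    rw [ae_all_iff]; intro f
    rw [ae_all_iff]; intro g
    have hd : ∀ x, ((ev Z x).submatrix f g).det = (Matrix.of fun i j => Z (f i) (g j)).det x :=
      fun x => det_ev (fun i j => Z (f i) (g j)) x
    rcases hR _ (det_mem R (fun i j => Z (f i) (g j)) fun i j => h _ _) with h0 | h0
    · filter_upwards [h0] with x hx
      rw [hd x, hx]
      simp [h0]
    · filter_upwards [h0] with x hx
      rw [hd x]
      refine ⟨fun h => absurd h hx, fun h => ?_⟩
      exfalso
      have := (h.and h0).exists
      obtain ⟨y, hy1, hy2⟩ := this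
      exact hy2 hy1
  obtain ⟨x₀, hx₀⟩ := h1.exists
  refine ⟨(ev Z x₀).rank, ?_⟩
  filter_upwards [h1] with x hx
  have h2 := (le_rank_iff (ev Z x₀) _).1 rfl
  rw [le_rank_iff]
  simp only [ne_eq, hx, hx₀] at h2 ⊢
  exact h2

lemma ev_rank_smul {ι κ : Type*} [Fintype ι] [Fintype κ] (Z : ι → κ → TT → ℂ) (g : TT → ℂ) (x : TT)
    (hg : g x ≠ 0) : (ev (fun i j => g * Z i j) x).rank = (ev Z x).rank := by
  have : ev (fun i j => g * Z i j) x = g x • ev Z x := by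
    ext i j; simp [ev]
  rw [this, Matrix.rank_smul_of_mem_nonZeroDivisors]
  exact mem_nonZeroDivisors_of_ne_zero hg

lemma rank_const' {ι κ : Type*} [Fintype ι] [Fintype κ] (R : Subring (TT → ℂ)) (hR : Dich R)
    (Z : ι → κ → TT → ℂ) (g : TT → ℂ) (hg : ∀ᵐ x ∂mu, g x ≠ 0) (h : ∀ i j, g * Z i j ∈ R) :
    ∃ r, ∀ᵐ x ∂mu, (ev Z x).rank = r := by
  obtain ⟨r, hr⟩ := rank_const R hR _ h
  refine ⟨r, ?_⟩
  filter_upwards [hr, hg] with x h1 h2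
  rwa [ev_rank_smul _ _ _ h2] at h1

lemma mult_family {ι : Type*} [Fintype ι] (f : ι → TT → ℂ) (hf : ∀ i, IsAn (f i)) :
    ∃ g : TT → ℂ, g ∈ HI ∧ (∀ᵐ x ∂mu, g x ≠ 0) ∧ ∀ i, g * f i ∈ HI := by
  classical
  choose g h1 h2 h3 h4 h5 using fun i => exists_multiplier (hf i)
  have hg : ∀ i, g i ∈ HI := fun i => ⟨(h1 i).1.1, h2 i, (h1 i).2⟩
  refine ⟨∏ i, g i, HI.prod_mem fun i _ => hg i, ?_, fun i => ?_⟩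
  · have := ae_all_iff.2 h3
    filter_upwards [this] with x hx
    rw [Finset.prod_apply, Finset.prod_ne_zero_iff]
    exact fun i _ => hx i
  · rw [← Finset.prod_erase_mul Finset.univ g (Finset.mem_univ i), mul_assoc]
    refine HI.mul_mem (HI.prod_mem fun i _ => hg i) ⟨(h4 i).1.1, h5 i, (h4 i).2⟩

/-- coanalytic -/
def IsCo (f : TT → ℂ) : Prop := MemLp f 2 mu ∧ ∀ n > 0, cf f n = 0

lemma mult_family_co {ι : Type*} [Fintype ι] (f : ι → TT → ℂ) (hf : ∀ i, IsCo (f i)) :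
    ∃ g : TT → ℂ, g ∈ HIm ∧ (∀ᵐ x ∂mu, g x ≠ 0) ∧ ∀ i, g * f i ∈ HIm := by
  obtain ⟨g, h1, h2, h3⟩ := mult_family (fun i x => conj (f i x)) (fun i =>
    ⟨memLp_conj (hf i).1, fun n hn => by rw [cf_conj, (hf i).2 _ (by omega), map_zero]⟩)
  have hc : starRingEnd (TT → ℂ) (starRingEnd (TT → ℂ) g) = g := star_star g
  refine ⟨starRingEnd _ g, ?_, ?_, fun i => ?_⟩
  · change starRingEnd (TT → ℂ) (starRingEnd (TT → ℂ) g) ∈ HI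
    rw [hc]; exact h1
  · filter_upwards [h2] with x hx
    simpa using hx
  · change starRingEnd (TT → ℂ) (starRingEnd (TT → ℂ) g * f i) ∈ HI
    rw [map_mul, hc]; exact h3 i

lemma HIm_spec {f : TT → ℂ} (hf : f ∈ HIm) : IsCo f := by
  obtain ⟨h1, ⟨C, h2⟩, h3⟩ : starRingEnd (TT → ℂ) f ∈ HI := hf
  have hm := memLp_of_bdd h1 C h2
  have hf' : f = fun x => conj ((starRingEnd (TT → ℂ) f) x) := by
    funext x; simp
  rw [hf']
  exact ⟨memLp_conj hm, fun n hn => by rw [cf_conj, h3 _ (by omega), map_zero]⟩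

lemma ker_eq {ι ι' κ : Type*} [Fintype ι] [Fintype ι'] [Fintype κ] (A : Matrix ι κ ℂ)
    (B : Matrix ι' κ ℂ) (h : ∀ v, A.mulVec v = 0 → B.mulVec v = 0) (hr : A.rank = B.rank) :
    ∀ v, B.mulVec v = 0 → A.mulVec v = 0 := by
  have h1 := A.mulVecLin.finrank_range_add_finrank_ker
  have h2 := B.mulVecLin.finrank_range_add_finrank_ker
  have hle : LinearMap.ker A.mulVecLin ≤ LinearMap.ker B.mulVecLin := fun v hv => h v hv
  simp only [Matrix.rank] at hr
  have := Submodule.eq_of_le_of_finrank_eq hle (by omega)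
  intro v hv
  have hv' : v ∈ LinearMap.ker B.mulVecLin := hv
  rw [← this] at hv'
  exact hv'

lemma rank_eq_of_ker {ι ι' κ : Type*} [Fintype ι] [Fintype ι'] [Fintype κ] (A : Matrix ι κ ℂ)
    (B : Matrix ι' κ ℂ) (h : ∀ v, A.mulVec v = 0 ↔ B.mulVec v = 0) : A.rank = B.rank := by
  have h1 := A.mulVecLin.finrank_range_add_finrank_ker
  have h2 := B.mulVecLin.finrank_range_add_finrank_ker
  have : LinearMap.ker A.mulVecLin = LinearMap.ker B.mulVecLin := by
    ext v; exact h v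
  rw [this] at h1
  simp only [Matrix.rank]; omega

lemma chain_ker {d m : ℕ} (z y : ℕ → Fin d → TT → ℂ) (φ : ℕ → TT → ℂ)
    (hz : ∀ i j, IsAn (z i j)) (hy : ∀ i, i < m → ∀ j, IsCo (y i j))
    (hyz : ∀ i, i < m → ∀ j x, y i j x = z i j x - φ i x * z (i + 1) j x)
    (hz0 : ∀ j, z 0 j =ᵐ[mu] 0) (hφ : ∀ i, i < m → ¬ (φ i =ᵐ[mu] 0)) :
    ∀ k, k ≤ m → ∀ᵐ x ∂mu, ∀ v : Fin d → ℂ, (∀ i, i < k → ∑ j, y i j x * v j = 0) →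
      ∀ i, i ≤ k → ∑ j, z i j x * v j = 0 := by
  intro k
  induction k with
  | zero =>
    intro _
    have := ae_all_iff.2 hz0
    filter_upwards [this] with x hx v _ i hi
    obtain rfl : i = 0 := by omega
    refine Finset.sum_eq_zero fun j _ => ?_
    rw [hx j]; simp
  | succ k ih =>
    intro hk
    have ih := ih (by omega)
    let Z : Fin (k + 2) → Fin d → TT → ℂ := fun i => z i
    let Y : Fin (k + 1) → Fin d → TT → ℂ := fun i => y i
    obtain ⟨rz, hrz⟩ : ∃ r, ∀ᵐ x ∂mu, (ev Z x).rank = r := by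
      obtain ⟨g, -, hg, hg2⟩ := mult_family (fun p : Fin (k + 2) × Fin d => Z p.1 p.2)
        (fun p => hz _ _)
      exact rank_const' HI dich_HI Z g hg fun i j => hg2 (i, j)
    obtain ⟨ry, hry⟩ : ∃ r, ∀ᵐ x ∂mu, (ev Y x).rank = r := by
      obtain ⟨g, -, hg, hg2⟩ := mult_family_co (fun p : Fin (k + 1) × Fin d => Y p.1 p.2)
        (fun p => hy _ (by have := p.1.2; omega) _)
      exact rank_const' HIm dich_HIm Y g hg fun i j => hg2 (i, j)
    have kz : ∀ x v, (ev Z x).mulVec v = 0 ↔ ∀ i, i ≤ k + 1 → ∑ j, z i j x * v j = 0 := by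
      intro x v
      constructor
      · intro h i hi
        exact congrFun h (⟨i, by omega⟩ : Fin (k + 2))
      · intro h; funext i
        exact h i (by have := i.2; omega)
    have ky : ∀ x v, (ev Y x).mulVec v = 0 ↔ ∀ i, i < k + 1 → ∑ j, y i j x * v j = 0 := by
      intro x v
      constructor
      · intro h i hi
        exact congrFun h (⟨i, by omega⟩ : Fin (k + 1))
      · intro h; funext i
        exact h i i.2
    have hrow : ∀ i, i < m → ∀ x (v : Fin d → ℂ), ∑ j, y i j x * v j =
        ∑ j, z i j x * v j - φ i x * ∑ j, z (i + 1) j x * v j := by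
      intro i hi x v
      rw [Finset.mul_sum, ← Finset.sum_sub_distrib]
      refine Finset.sum_congr rfl fun j _ => ?_
      rw [hyz i hi]; ring
    have hzy : ∀ x v, (ev Z x).mulVec v = 0 → (ev Y x).mulVec v = 0 := by
      intro x v h
      rw [kz] at h
      rw [ky]
      intro i hi
      rw [hrow i (by omega), h i (by omega), h (i + 1) (by omega)]; simp
    have hfreq : ∃ᶠ x in ae mu, φ k x ≠ 0 := by
      intro h
      apply hφ k (by omega)
      filter_upwards [h] with x hx
      simpa using hx
    have hrr : rz = ry := by
      obtain ⟨x, hx, h1, h2, h3⟩ := (hfreq.and_eventually (hrz.and (hry.and ih))).exists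
      rw [← h1, ← h2]
      refine rank_eq_of_ker _ _ fun v => ⟨hzy x v, fun h => ?_⟩
      rw [ky] at h
      rw [kz]
      have h4 := h3 v (fun i hi => h i (by omega))
      intro i hi
      rcases Nat.lt_or_ge i (k + 1) with h5 | h5
      · exact h4 i (by omega)
      · obtain rfl : i = k + 1 := by omega
        have h6 := h k (by omega)
        rw [hrow k (by omega), h4 k le_rfl, zero_sub, neg_eq_zero, mul_eq_zero] at h6
        exact h6.resolve_left hx
    filter_upwards [hrz, hry] with x h1 h2 v hv
    have := ker_eq _ _ (hzy x) (by rw [h1, h2, hrr]) v ((ky x v).2 hv)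
    exact (kz x v).1 this

lemma cf_sum {ι : Type*} (s : Finset ι) (f : ι → TT → ℂ) (hf : ∀ i, Integrable (f i) mu) (n : ℤ) :
    cf (fun x => ∑ i ∈ s, f i x) n = ∑ i ∈ s, cf (f i) n := by
  simp only [cf, Finset.mul_sum]
  exact integral_finsetSum _ fun i _ => integrable_cont_mul _ (hf i)

lemma cf_sum_zero {ι : Type*} (s : Finset ι) (b : ι → ℂ) (q u : ι → TT → ℂ)
    (hq : ∀ i, MemLp (q i) 2 mu) (hu : ∀ i, MemLp (u i) 2 mu) (n : ℤ)
    (h : ∀ i, cf (fun x => q i x * u i x) n = 0) :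
    cf (fun x => ∑ i ∈ s, b i * (q i x * u i x)) n = 0 := by
  have := cf_sum s (fun i x => b i * (q i x * u i x))
    (fun i => (integrable_mul2 (hq i) (hu i)).const_mul (b i)) n
  rw [this]
  refine Finset.sum_eq_zero fun i _ => ?_
  rw [cf_smul, h, mul_zero]

lemma adj_ev {r : ℕ} (Z : Fin r → Fin r → TT → ℂ) (x : TT) (i j : Fin r) :
    (ev Z x).adjugate i j = (Matrix.of Z).adjugate i j x := by
  have := RingHom.map_adjugate (Pi.evalRingHom (fun _ : TT => ℂ) x) (Matrix.of Z)
  exact (congrFun (congrFun this i) j).symm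

lemma adj_mem {r : ℕ} (R : Subring (TT → ℂ)) (Z : Fin r → Fin r → TT → ℂ) (h : ∀ i j, Z i j ∈ R)
    (i j : Fin r) : (Matrix.of Z).adjugate i j ∈ R := by
  rw [Matrix.adjugate_apply]
  refine det_mem R _ fun a b => ?_
  change Matrix.updateRow (Matrix.of Z) j (Pi.single i 1) a b ∈ R
  rw [Matrix.updateRow_apply]
  split_ifs
  · rw [Pi.single_apply]
    split_ifs
    · exact R.one_mem
    · exact R.zero_mem
  · exact h a b

lemma contra {d m : ℕ} (y : ℕ → Fin d → TT → ℂ) (hy : ∀ i, i < m → ∀ j, IsCo (y i j))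
    (hker : ∀ᵐ x ∂mu, ∀ v : Fin d → ℂ, (∀ i, i < m → ∑ j, y i j x * v j = 0) → v = 0)
    (b : Fin d → ℂ)
    (hc : ∀ N : ℕ, ∃ c : Fin d → TT → ℂ, (∀ x, ∑ j, b j * c j x = 1) ∧
      ∀ i, i < m → ∃ u : TT → ℂ, MemLp u 2 mu ∧ (∀ n : ℤ, -(N : ℤ) ≤ n → cf u n = 0) ∧
        ∀ᵐ x ∂mu, ∑ j, y i j x * c j x = u x) : False := by
  obtain ⟨g, hg0, hg, hg2⟩ := mult_family_co (fun p : Fin m × Fin d => y p.1 p.2)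
    (fun p => hy _ p.1.2 _)
  let Y : Fin m → Fin d → TT → ℂ := fun i j => g * y i j
  have hY : ∀ i j, Y i j ∈ HIm := fun i j => hg2 (i, j)
  have hall : ∀ f : Fin d → Fin m, ∀ᵐ x ∂mu, (ev (fun a => Y (f a)) x).det = 0 := by
    intro f
    let D : Fin d → Fin d → TT → ℂ := fun a => Y (f a)
    have hD : ∀ i j, D i j ∈ HIm := fun i j => hY _ _
    have hdet := HIm_spec (det_mem HIm D hD)
    have h0 : (Matrix.of D).det =ᵐ[mu] (fun _ => (0 : ℂ)) := by
      refine ae_eq_of_cf (mem_int hdet.1) (integrable_const _) fun n => ?_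
      have hz : cf (fun _ : TT => (0 : ℂ)) n = 0 := by rw [cf_const]; simp
      rw [hz]
      obtain ⟨c, hc1, hc2⟩ := hc n.natAbs
      choose u hu1 hu2 hu3 using hc2
      let U : Fin d → TT → ℂ := fun a => u (f a) (f a).2
      have hUm : ∀ a, MemLp (U a) 2 mu := fun a => hu1 _ _
      have hUc : ∀ a, ∀ k : ℤ, -(n.natAbs : ℤ) ≤ k → cf (U a) k = 0 := fun a => hu2 _ _
      have hae : ∀ᵐ x ∂mu, ∀ a, ∑ j, y (f a) j x * c j x = U a x :=
        ae_all_iff.2 fun a => hu3 _ (f a).2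
      clear_value U
      let Q : Fin d → Fin d → TT → ℂ := fun j a => (Matrix.of D).adjugate j a * g
      have hQ : ∀ j a, IsCo (Q j a) := fun j a =>
        HIm_spec (HIm.mul_mem (adj_mem HIm D hD j a) hg0)
      have hmain : (Matrix.of D).det =ᵐ[mu]
          fun x => ∑ p : Fin d × Fin d, b p.1 * (Q p.1 p.2 x * U p.2 x) := by
        filter_upwards [hae] with x hx
        have e1 : ∀ j, ∑ a, (Matrix.of D).adjugate j a x * (g x * U a x) =
            (Matrix.of D).det x * c j x := by
          intro j
          have h2 := congrFun (congrArg (fun M => Matrix.mulVec M (fun j => c j x))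
            (Matrix.adjugate_mul (ev D x))) j
          simp only [← Matrix.mulVec_mulVec, Matrix.smul_mulVec, Matrix.one_mulVec] at h2
          rw [← det_ev]
          simp only [← adj_ev]
          refine Eq.trans ?_ h2
          simp only [Matrix.mulVec, dotProduct]
          refine Finset.sum_congr rfl fun a _ => ?_
          rw [← hx a, Finset.mul_sum]
          congr 1
          refine Finset.sum_congr rfl fun j' _ => ?_
          simp only [ev, D, Y, Matrix.of_apply, Pi.mul_apply]; ring
        rw [Fintype.sum_prod_type]
        calc (Matrix.of D).det x = (Matrix.of D).det x * ∑ j, b j * c j x := by rw [hc1, mul_one]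
          _ = ∑ j, b j * ((Matrix.of D).det x * c j x) := by
              rw [Finset.mul_sum]; refine Finset.sum_congr rfl fun j _ => ?_; ring
          _ = _ := by
              refine Finset.sum_congr rfl fun j _ => ?_
              rw [← e1, Finset.mul_sum]
              refine Finset.sum_congr rfl fun a _ => ?_
              simp only [Q, Pi.mul_apply]; ring
      rw [cf_congr hmain]
      refine cf_sum_zero Finset.univ (fun p : Fin d × Fin d => b p.1) (fun p => Q p.1 p.2)
        (fun p => U p.2) (fun p => (hQ p.1 p.2).1) (fun p => hUm p.2) n (fun p => ?_)
      exact cf_mul_high (hQ p.1 p.2).1 (hUm p.2) 0 (-(n.natAbs : ℤ) - 1)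
        (hQ p.1 p.2).2 (fun k hk => hUc p.2 k (by omega)) n (by omega)
    filter_upwards [h0] with x hx
    rw [det_ev]; exact hx
  obtain ⟨x, hx1, hx2, hx3⟩ := ((ae_all_iff.2 hall).and (hker.and hg)).exists
  have hk : ∀ v, (ev Y x).mulVec v = 0 → v = 0 := by
    intro v hv
    apply hx2
    intro i hi
    have := congrFun hv ⟨i, hi⟩
    simp only [Matrix.mulVec, dotProduct, ev, Y, Matrix.of_apply, Pi.mul_apply, Pi.zero_apply,
      mul_assoc, ← Finset.mul_sum] at this
    exact (mul_eq_zero.1 this).resolve_left hx3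
  have hrank : (ev Y x).rank = d := by
    have h1 := (ev Y x).mulVecLin.finrank_range_add_finrank_ker
    have h2 : LinearMap.ker (ev Y x).mulVecLin = ⊥ := by
      rw [LinearMap.ker_eq_bot']
      exact hk
    rw [h2] at h1
    simpa [Matrix.rank] using h1
  obtain ⟨f, hf⟩ := exists_rows _ d hrank
  have h3 : (ev (fun a => Y (f a)) x).rank = d := by
    have := hf.rank_matrix
    rwa [Fintype.card_fin] at this
  have h4 : LinearIndependent ℂ (ev (fun a => Y (f a)) x).row := hf
  rw [Matrix.linearIndependent_rows_iff_isUnit, Matrix.isUnit_iff_isUnit_det, hx1 f] at h4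
  exact not_isUnit_zero h4

variable {H : Type*} [NormedAddCommGroup H] [InnerProductSpace ℂ H]

/-- coordinate functionals of the Dirichlet space -/
structure Coord (X : ℕ → H →L[ℂ] ℂ) : Prop where
  hs : ∀ x, HasSum (fun n : ℕ => ((n : ℝ) + 1) * ‖X n x‖ ^ 2) (‖x‖ ^ 2)
  real : ∀ a : ℕ → ℂ, Summable (fun n : ℕ => ((n : ℝ) + 1) * ‖a n‖ ^ 2) → ∃ x, ∀ n, X n x = a n

/-- Toeplitz operators in coordinates -/
def IsToep (X : ℕ → H →L[ℂ] ℂ) (T : H →L[ℂ] H) (c : ℤ → ℂ) : Prop :=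
  ∀ x (k : ℕ), HasSum (fun n : ℕ => c ((k : ℤ) - n) * X n x) (X k (T x))

lemma Coord.ext {X : ℕ → H →L[ℂ] ℂ} (hX : Coord X) {x y : H} (h : ∀ n, X n x = X n y) : x = y := by
  have h1 := hX.hs (x - y)
  have h2 : (fun n : ℕ => ((n : ℝ) + 1) * ‖X n (x - y)‖ ^ 2) = fun _ => 0 := by
    funext n; rw [map_sub, h, sub_self]; simp
  rw [h2] at h1
  have h3 := h1.unique hasSum_zero
  have h4 : ‖x - y‖ = 0 := by simpa using h3
  exact sub_eq_zero.1 (norm_eq_zero.1 h4)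

lemma Coord.basis {X : ℕ → H →L[ℂ] ℂ} (hX : Coord X) (N : ℕ) :
    ∃ x, ∀ n, X n x = if n = N then 1 else 0 := by
  apply hX.real
  refine summable_of_ne_finset_zero (s := {N}) fun n hn => ?_
  rw [if_neg (by simpa using hn)]; simp

lemma Coord.shift {X : ℕ → H →L[ℂ] ℂ} (hX : Coord X) (x : H) (N : ℕ) :
    ∃ s, (∀ n < N, X n s = 0) ∧ (∀ n, X (n + N) s = X n x) ∧ ‖s‖ ^ 2 ≤ ((N : ℝ) + 1) * ‖x‖ ^ 2 := by
  let a : ℕ → ℂ := fun n => if n < N then 0 else X (n - N) x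
  have ha : ∀ n, a (n + N) = X n x := fun n => by simp [a]
  have hle : ∀ n : ℕ, ((n + N : ℕ) + 1 : ℝ) * ‖a (n + N)‖ ^ 2 ≤
      ((N : ℝ) + 1) * (((n : ℝ) + 1) * ‖X n x‖ ^ 2) := by
    intro n
    rw [ha, ← mul_assoc]
    gcongr
    push_cast
    nlinarith [(Nat.cast_nonneg n : (0:ℝ) ≤ n), (Nat.cast_nonneg N : (0:ℝ) ≤ N),
      mul_nonneg (Nat.cast_nonneg n : (0:ℝ) ≤ n) (Nat.cast_nonneg N : (0:ℝ) ≤ N)]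
  have hsum := (hX.hs x).mul_left ((N : ℝ) + 1)
  have h1 : Summable (fun n : ℕ => ((n + N : ℕ) + 1 : ℝ) * ‖a (n + N)‖ ^ 2) :=
    Summable.of_nonneg_of_le (fun n => by positivity) hle hsum.summable
  have h2 : Summable (fun n : ℕ => ((n : ℝ) + 1) * ‖a n‖ ^ 2) := by
    rw [← summable_nat_add_iff N]; exact h1
  obtain ⟨s, hs⟩ := hX.real a h2
  refine ⟨s, fun n hn => by rw [hs]; simp [a, hn], fun n => by rw [hs, ha], ?_⟩
  have h3 := hX.hs s
  simp only [hs] at h3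
  rw [← h3.tsum_eq, ← h2.sum_add_tsum_nat_add N, Finset.sum_eq_zero, zero_add]
  · refine (h1.tsum_le_tsum hle hsum.summable).trans_eq hsum.tsum_eq
  · intro n hn
    simp [a, Finset.mem_range.1 hn]

lemma conv_exists {X : ℕ → H →L[ℂ] ℂ} (hX : Coord X) {T : H →L[ℂ] H} {c : ℤ → ℂ}
    (hT : IsToep X T c) (x : H) : ∃ v : ℤ → ℂ,
      (∀ k : ℤ, HasSum (fun n : ℕ => c (k - n) * X n x) (v k)) ∧ Summable fun k => ‖v k‖ ^ 2 := by
  choose s hs0 hs1 hs2 using hX.shift x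
  have h1 : ∀ N j : ℕ, HasSum (fun n : ℕ => c ((j : ℤ) - N - n) * X n x) (X j (T (s N))) := by
    intro N j
    have h := hT (s N) j
    rw [← (add_left_injective N).hasSum_iff] at h
    · convert h using 1
      funext n
      simp only [Function.comp]
      rw [hs1]
      congr 2; push_cast; ring
    · intro n hn
      have : n < N := by
        by_contra hlt
        exact hn ⟨n - N, by simp; omega⟩
      rw [hs0 N n this, mul_zero]
  let v : ℤ → ℂ := fun k => ∑' n : ℕ, c (k - n) * X n x
  have h2 : ∀ (k : ℤ) (N j : ℕ), k = (j : ℤ) - N → v k = X j (T (s N)) := by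
    rintro k N j rfl
    exact (h1 N j).tsum_eq
  refine ⟨v, fun k => ?_, ?_⟩
  · have h3 := h1 k.natAbs (k + k.natAbs).toNat
    have e : (((k + k.natAbs).toNat : ℕ) : ℤ) - (k.natAbs : ℤ) = k := by omega
    rw [e] at h3
    exact h3.summable.hasSum
  · refine summable_of_sum_le (c := 2 * ‖T‖ ^ 2 * ‖x‖ ^ 2) (fun k => by positivity) fun u => ?_
    let M := u.sup Int.natAbs
    have hM : ∀ k ∈ u, k.natAbs ≤ M := fun k hk => Finset.le_sup (f := Int.natAbs) hk
    let N := 2 * M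
    have hinj : Set.InjOn (fun k : ℤ => (k + N).toNat) u := by
      intro k hk l hl hkl
      have := hM k hk
      have := hM l hl
      simp only at hkl
      omega
    have hst : ‖T (s N)‖ ^ 2 ≤ ‖T‖ ^ 2 * (((N : ℝ) + 1) * ‖x‖ ^ 2) := by
      calc ‖T (s N)‖ ^ 2 ≤ (‖T‖ * ‖s N‖) ^ 2 := by gcongr; exact T.le_opNorm _
        _ = ‖T‖ ^ 2 * ‖s N‖ ^ 2 := by ring
        _ ≤ _ := by gcongr; exact hs2 N
    have h4 : ∑ k ∈ u, ((((k + N).toNat : ℕ) : ℝ) + 1) * ‖v k‖ ^ 2 ≤ ‖T (s N)‖ ^ 2 := by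
      have h5 := sum_le_hasSum (u.image fun k : ℤ => (k + N).toNat) (fun n _ => by positivity)
        (hX.hs (T (s N)))
      rw [Finset.sum_image hinj] at h5
      refine le_trans (le_of_eq ?_) h5
      refine Finset.sum_congr rfl fun k hk => ?_
      have := hM k hk
      rw [h2 k N (k + N).toNat (by omega)]
    have h6 : ((N : ℝ) + 1) * ∑ k ∈ u, ‖v k‖ ^ 2 ≤
        2 * ∑ k ∈ u, ((((k + N).toNat : ℕ) : ℝ) + 1) * ‖v k‖ ^ 2 := by
      rw [Finset.mul_sum, Finset.mul_sum]
      refine Finset.sum_le_sum fun k hk => ?_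
      rw [← mul_assoc]
      gcongr
      have := hM k hk
      have h7 : N + 1 ≤ 2 * ((k + N).toNat + 1) := by omega
      exact_mod_cast h7
    have hN : (0 : ℝ) < (N : ℝ) + 1 := by positivity
    refine le_of_mul_le_mul_left ?_ hN
    calc _ ≤ _ := h6
      _ ≤ 2 * (‖T‖ ^ 2 * (((N : ℝ) + 1) * ‖x‖ ^ 2)) := by gcongr; exact h4.trans hst
      _ = _ := by ring

lemma toep_summable {X : ℕ → H →L[ℂ] ℂ} (hX : Coord X) {T : H →L[ℂ] H} {c : ℤ → ℂ}
    (hT : IsToep X T c) : Summable fun k => ‖c k‖ ^ 2 := by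
  obtain ⟨x, hx⟩ := hX.basis 0
  obtain ⟨v, hv, hv2⟩ := conv_exists hX hT x
  have : v = c := by
    funext k
    refine (hv k).unique ?_
    have h := hasSum_ite_eq (0 : ℕ) (c k)
    convert h using 1
    funext n
    rw [hx]
    split_ifs with h0
    · subst h0; simp
    · simp
  rwa [this] at hv2

/-- `f` represents `x` -/
def Rep (X : ℕ → H →L[ℂ] ℂ) (x : H) (f : TT → ℂ) : Prop :=
  MemLp f 2 mu ∧ (∀ n : ℕ, cf f n = X n x) ∧ ∀ n : ℤ, n < 0 → cf f n = 0

lemma Rep.an {X : ℕ → H →L[ℂ] ℂ} {x : H} {f : TT → ℂ} (h : Rep X x f) : IsAn f := ⟨h.1, h.2.2⟩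

lemma Rep.ae_eq {X : ℕ → H →L[ℂ] ℂ} {x : H} {f g : TT → ℂ} (hf : Rep X x f) (hg : Rep X x g) :
    f =ᵐ[mu] g := by
  refine ae_eq_of_cf (mem_int hf.1) (mem_int hg.1) fun n => ?_
  rcases lt_or_ge n 0 with h | h
  · rw [hf.2.2 n h, hg.2.2 n h]
  · obtain ⟨k, rfl⟩ := Int.eq_ofNat_of_zero_le h
    rw [hf.2.1, hg.2.1]

lemma exists_rep {X : ℕ → H →L[ℂ] ℂ} (hX : Coord X) (x : H) : ∃ f, Rep X x f := by
  let a : ℤ → ℂ := fun n => if n < 0 then 0 else X n.toNat x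
  have ha : ∀ n : ℕ, a n = X n x := fun n => by simp [a]
  have h1 : Summable fun n : ℤ => ‖a n‖ ^ 2 := by
    have h2 : Summable fun n : ℕ => ‖a n‖ ^ 2 := by
      refine Summable.of_nonneg_of_le (fun n => by positivity) (fun n => ?_) (hX.hs x).summable
      rw [ha]
      have : (0 : ℝ) ≤ n := Nat.cast_nonneg n
      nlinarith [sq_nonneg ‖X n x‖]
    rw [← Nat.cast_injective.summable_iff] 
    · exact h2
    · intro n hn
      have : n < 0 := by
        by_contra h
        exact hn ⟨n.toNat, by simp; omega⟩
      simp [a, this]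
  obtain ⟨f, hf, hf2⟩ := realize h1
  exact ⟨f, hf, fun n => by rw [hf2, ha], fun n hn => by rw [hf2]; simp [a, hn]⟩

lemma Rep.add {X : ℕ → H →L[ℂ] ℂ} {x y : H} {f g : TT → ℂ} (hf : Rep X x f) (hg : Rep X y g) :
    Rep X (x + y) (f + g) :=
  ⟨hf.1.add hg.1, fun n => by
    rw [cf_add (mem_int hf.1) (mem_int hg.1), hf.2.1, hg.2.1, map_add], fun n hn => by
    rw [cf_add (mem_int hf.1) (mem_int hg.1), hf.2.2 n hn, hg.2.2 n hn, add_zero]⟩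

lemma Rep.smul {X : ℕ → H →L[ℂ] ℂ} {x : H} {f : TT → ℂ} (c : ℂ) (hf : Rep X x f) :
    Rep X (c • x) (fun t => c * f t) :=
  ⟨hf.1.const_mul c, fun n => by
    rw [cf_smul, hf.2.1, map_smul, smul_eq_mul], fun n hn => by
    rw [cf_smul, hf.2.2 n hn, mul_zero]⟩

lemma Rep.zero (X : ℕ → H →L[ℂ] ℂ) : Rep X (0 : H) (fun _ => 0) :=
  ⟨memLp_const 0, fun n => by rw [cf_const]; simp, fun n hn => by rw [cf_const]; simp⟩

lemma Rep.sum {X : ℕ → H →L[ℂ] ℂ} {ι : Type*} (s : Finset ι) (c : ι → ℂ) {x : ι → H}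
    {f : ι → TT → ℂ} (hf : ∀ i, Rep X (x i) (f i)) :
    Rep X (∑ i ∈ s, c i • x i) (fun t => ∑ i ∈ s, c i * f i t) := by
  classical
  induction s using Finset.induction_on with
  | empty => simpa using Rep.zero X
  | insert a s ha ih =>
    simp only [Finset.sum_insert ha]
    exact ((hf a).smul (c a)).add ih

lemma Rep.shift {X : ℕ → H →L[ℂ] ℂ} {x s : H} {f : TT → ℂ} (hf : Rep X x f) (h0 : X 0 s = 0)
    (h1 : ∀ n, X (n + 1) s = X n x) : Rep X s (fun t => fourier 1 t * f t) :=
  ⟨memLp_fourier_mul _ hf.1, fun n => by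
    rw [cf_fourier_mul]
    cases n with
    | zero => rw [h0]; exact hf.2.2 _ (by norm_num)
    | succ n => rw [h1, ← hf.2.1]; congr 1; push_cast; ring, fun n hn => by
    rw [cf_fourier_mul]; exact hf.2.2 _ (by omega)⟩

lemma Rep.one {X : ℕ → H →L[ℂ] ℂ} {x : H} (hx : ∀ n, X n x = if n = 0 then 1 else 0) :
    Rep X x (fun _ => 1) :=
  ⟨memLp_const 1, fun n => by rw [cf_const, hx]; simp, fun n hn => by
    rw [cf_const, if_neg hn.ne]⟩

lemma symbol {X : ℕ → H →L[ℂ] ℂ} (hX : Coord X) {T : H →L[ℂ] H} {c : ℤ → ℂ}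
    (hT : IsToep X T c) : ∃ φ : TT → ℂ, (φ =ᵐ[mu] 0 → ∀ k, c k = 0) ∧
      ∀ x f, Rep X x f → MemLp (fun t => φ t * f t) 2 mu ∧
        ∀ k : ℕ, cf (fun t => φ t * f t) k = X k (T x) := by
  obtain ⟨φ, hφ, hφc⟩ := realize (toep_summable hX hT)
  refine ⟨φ, fun h k => ?_, fun x f hf => ?_⟩
  · rw [← hφc, cf_congr h]
    have := cf_const 0 k
    rw [ite_self] at this; exact this
  · obtain ⟨v, hv, hv2⟩ := conv_exists hX hT x
    have h1 : ∀ n, cf (fun t => φ t * f t) n = v n := by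
      intro n
      refine HasSum.unique ?_ (hv n)
      have h2 := cf_mul_hasSum hφ hf.1 n
      rw [← (Nat.cast_injective (R := ℤ)).hasSum_iff] at h2
      · convert h2 using 1
        funext k
        simp only [Function.comp]
        rw [hφc, hf.2.1]
      · intro k hk
        have : k < 0 := by
          by_contra h
          exact hk ⟨k.toNat, by simp; omega⟩
        rw [hf.2.2 k this, mul_zero]
    have hInt := integrable_mul2 hφ hf.1
    refine ⟨memLp_of_cf hInt (by simpa only [h1] using hv2), fun k => ?_⟩
    rw [h1]
    exact (hv k).unique (hT x k)


/-- columns of the unipotent matrix -/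
def UU (T : ℕ → H →L[ℂ] H) (E0 : H) : ℕ → ℕ → H
  | _, 0 => E0
  | i, t + 1 => T i (UU T E0 (i + 1) t)

/-- entries of the unipotent matrix -/
def xx (T : ℕ → H →L[ℂ] H) (E0 : H) (i k : ℕ) : H := if i ≤ k then UU T E0 i (k - i) else 0

lemma xx_rec (T : ℕ → H →L[ℂ] H) (E0 : H) (i k : ℕ) :
    xx T E0 i k = T i (xx T E0 (i + 1) k) + (if i = k then (1 : ℂ) else 0) • E0 := by
  unfold xx
  rcases lt_trichotomy i k with h | h | h
  · rw [if_pos h.le, if_pos (by omega), if_neg h.ne, zero_smul, add_zero]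
    obtain ⟨t, rfl⟩ : ∃ t, k = i + 1 + t := ⟨k - (i + 1), by omega⟩
    rw [show i + 1 + t - i = t + 1 by omega, show i + 1 + t - (i + 1) = t by omega]
    rfl
  · subst h
    simp [UU]
  · rw [if_neg (by omega), if_neg (by omega), if_neg (by omega)]; simp

/-- chains -/
def ch (T : ℕ → H →L[ℂ] H) (E0 : H) (m : ℕ) (w : Fin (m + 1) → ℂ) (i : ℕ) : H :=
  ∑ k, w k • xx T E0 i k

lemma ch_rec (T : ℕ → H →L[ℂ] H) (E0 : H) (m : ℕ) (w : Fin (m + 1) → ℂ) (i : Fin (m + 1)) :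
    ch T E0 m w i = T i (ch T E0 m w (i + 1)) + w i • E0 := by
  unfold ch
  rw [map_sum]
  have : ∀ k : Fin (m + 1), w k • xx T E0 i k = T i (w k • xx T E0 (i + 1) k) +
      (if i = k then w k • E0 else 0) := by
    intro k
    rw [xx_rec, map_smul, smul_add]
    congr 1
    by_cases h : i = k
    · subst h; simp
    · rw [if_neg h, if_neg (fun h' => h (Fin.ext h'))]; simp
  rw [Finset.sum_congr rfl fun k _ => this k, Finset.sum_add_distrib]
  simp

lemma ch_top (T : ℕ → H →L[ℂ] H) (E0 : H) (m : ℕ) (w : Fin (m + 1) → ℂ) :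
    ch T E0 m w m = w (Fin.last m) • E0 := by
  have h := ch_rec T E0 m w (Fin.last m)
  have h2 : ch T E0 m w (m + 1) = 0 := by
    unfold ch
    refine Finset.sum_eq_zero fun k _ => ?_
    unfold xx
    rw [if_neg (by have := k.2; omega), smul_zero]
  rw [Fin.val_last, h2, map_zero, zero_add] at h
  exact h

lemma ch_unique (T : ℕ → H →L[ℂ] H) (E0 : H) (m : ℕ) (w : Fin (m + 1) → ℂ) (x : ℕ → H)
    (hm : x m = w (Fin.last m) • E0)
    (hr : ∀ i (hi : i < m), x i = T i (x (i + 1)) + w ⟨i, by omega⟩ • E0) :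
    ∀ i, i ≤ m → x i = ch T E0 m w i := by
  have : ∀ t i, i + t = m → x i = ch T E0 m w i := by
    intro t
    induction t with
    | zero =>
      intro i hi
      obtain rfl : i = m := by omega
      exact hm.trans (ch_top T E0 _ w).symm
    | succ t ih =>
      intro i hi
      have h := ch_rec T E0 m w ⟨i, by omega⟩
      rw [h, hr i (by omega), ih (i + 1) (by omega)]
  exact fun i hi => this (m - i) i (by omega)

lemma ch_lin (T : ℕ → H →L[ℂ] H) (E0 : H) (m : ℕ) {d : ℕ} (b : Fin d → Fin (m + 1) → ℂ)
    (a : Fin d → ℂ) (i : ℕ) :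
    ch T E0 m (∑ j, a j • b j) i = ∑ j, a j • ch T E0 m (b j) i := by
  unfold ch
  simp only [Finset.sum_apply, Pi.smul_apply, Finset.smul_sum, Finset.sum_smul, smul_smul,
    smul_eq_mul]
  rw [Finset.sum_comm]

/-- starting values giving a chain ending in zero -/
def WW (T : ℕ → H →L[ℂ] H) (E0 : H) (m : ℕ) : Submodule ℂ (Fin (m + 1) → ℂ) where
  carrier := {w | ch T E0 m w 0 = 0}
  add_mem' := by
    intro a b ha hb
    simp only [Set.mem_ofPred_eq, ch, Pi.add_apply, add_smul, Finset.sum_add_distrib] at *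
    rw [ha, hb, add_zero]
  zero_mem' := by simp [ch]
  smul_mem' := by
    intro c a ha
    simp only [Set.mem_ofPred_eq, ch, Pi.smul_apply, smul_eq_mul, mul_smul, ← Finset.smul_sum] at *
    rw [ha, smul_zero]

theorem main {X : ℕ → H →L[ℂ] ℂ} (hX : Coord X) (m : ℕ) (T : ℕ → H →L[ℂ] H) (c : ℕ → ℤ → ℂ)
    (hT : ∀ i, i < m → IsToep X (T i) (c i)) (P : ℕ → H →L[ℂ] H) (hPm : P m = 1)
    (hP : ∀ i, i < m → P i = T i * P (i + 1)) (hP0 : P 0 = 0) :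
    ∃ i, i < m ∧ ∀ k, c i k = 0 := by
  by_contra hcon
  push Not at hcon
  choose E hE using hX.basis
  choose F hF using exists_rep hX
  have hsym : ∀ i, ∃ φ : TT → ℂ, i < m → (¬ (φ =ᵐ[mu] 0)) ∧
      ∀ x f, Rep X x f → MemLp (fun t => φ t * f t) 2 mu ∧
        ∀ k : ℕ, cf (fun t => φ t * f t) k = X k (T i x) := by
    intro i
    by_cases hi : i < m
    · obtain ⟨φ, h1, h2⟩ := symbol hX (hT i hi)
      refine ⟨φ, fun _ => ⟨fun h => ?_, h2⟩⟩
      obtain ⟨k, hk⟩ := hcon i hi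
      exact hk (h1 h k)
    · exact ⟨0, fun h => absurd h hi⟩
  choose φ hφ using hsym
  -- difference of a chain step
  have hstep : ∀ i, i < m → ∀ x x' (N : ℕ), (∀ n, n > N → X n x = X n (T i x')) →
      MemLp (fun t => F x t - φ i t * F x' t) 2 mu ∧
      ∀ n : ℤ, n > N → cf (fun t => F x t - φ i t * F x' t) n = 0 := by
    intro i hi x x' N h
    obtain ⟨h1, h2⟩ := (hφ i hi).2 x' (F x') (hF x')
    refine ⟨(hF x).1.sub h1, fun n hn => ?_⟩
    have h3 := cf_sub (mem_int (hF x).1) (mem_int h1) n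
    refine h3.trans ?_
    obtain ⟨k, rfl⟩ : ∃ k : ℕ, n = k := ⟨n.toNat, by omega⟩
    rw [(hF x).2.1, h2, h k (by omega), sub_self]
  let W := WW T (E 0) m
  let d := Module.finrank ℂ W
  let B : Module.Basis (Fin d) ℂ W := Module.finBasis ℂ W
  let b : Fin d → Fin (m + 1) → ℂ := fun j => (B j : Fin (m + 1) → ℂ)
  have hbli : LinearIndependent ℂ b :=
    B.linearIndependent.map' W.subtype (Submodule.ker_subtype W)
  have hb0 : ∀ j, ch T (E 0) m (b j) 0 = 0 := fun j => (B j).2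
  have hbsp : ∀ w, ch T (E 0) m w 0 = 0 → ∃ a : Fin d → ℂ, w = ∑ j, a j • b j := by
    intro w hw
    let w' : W := ⟨w, hw⟩
    refine ⟨fun j => B.repr w' j, ?_⟩
    have := congrArg W.subtype (B.sum_repr w')
    rw [map_sum] at this
    simpa [b] using this.symm
  let z : ℕ → Fin d → TT → ℂ := fun i j => F (ch T (E 0) m (b j) i)
  let y : ℕ → Fin d → TT → ℂ := fun i j t => z i j t - φ i t * z (i + 1) j t
  have hz : ∀ i j, IsAn (z i j) := fun i j => (hF _).an
  have hy : ∀ i, i < m → ∀ j, IsCo (y i j) := by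
    intro i hi j
    have := hstep i hi (ch T (E 0) m (b j) i) (ch T (E 0) m (b j) (i + 1)) 0 (fun n hn => by
      have h := ch_rec T (E 0) m (b j) ⟨i, by omega⟩
      simp only at h
      rw [h, map_add, map_smul, hE, if_neg (by omega), smul_zero, add_zero])
    exact ⟨this.1, fun n hn => this.2 n (by simpa using hn)⟩
  have hz0 : ∀ j, z 0 j =ᵐ[mu] 0 := by
    intro j
    have h1 := hF (ch T (E 0) m (b j) 0)
    rw [hb0] at h1
    have h2 := h1.ae_eq (Rep.zero X)
    simp only [z, hb0]
    exact h2
  have hck := chain_ker (m := m) z y φ hz hy (fun i hi j x => rfl) hz0 (fun i hi => (hφ i hi).1)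
    m le_rfl
  -- unipotence
  have huni : ∀ᵐ t ∂mu, ∀ v : Fin d → ℂ, (∀ i, i ≤ m → ∑ j, z i j t * v j = 0) → v = 0 := by
    have h1 : ∀ᵐ t ∂mu, ∀ (i : Fin (m + 1)) (j : Fin d),
        z i j t = ∑ k, b j k * F (xx T (E 0) i k) t := by
      refine ae_all_iff.2 fun i => ae_all_iff.2 fun j => ?_
      exact (hF (ch T (E 0) m (b j) i)).ae_eq
        (Rep.sum (X := X) Finset.univ (b j) (fun k => hF (xx T (E 0) i k)))
    have h2 : ∀ᵐ t ∂mu, F (E 0) t = 1 := (hF (E 0)).ae_eq (Rep.one (hE 0))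
    have h3 : ∀ᵐ t ∂mu, F 0 t = 0 := (hF 0).ae_eq (Rep.zero X)
    filter_upwards [h1, h2, h3] with t h1 h2 h3 v hv
    let w : Fin (m + 1) → ℂ := ∑ j, v j • b j
    have hrow : ∀ i : Fin (m + 1), ∑ k : Fin (m + 1), F (xx T (E 0) i k) t * w k = 0 := by
      intro i
      rw [← hv i (by have := i.2; omega)]
      simp only [h1, w, Finset.sum_apply, Pi.smul_apply, smul_eq_mul, Finset.mul_sum,
        Finset.sum_mul]
      rw [Finset.sum_comm]
      refine Finset.sum_congr rfl fun j _ => Finset.sum_congr rfl fun k _ => ?_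
      ring
    have hw : ∀ s i : ℕ, i + s = m → ∀ k : Fin (m + 1), i ≤ k → w k = 0 := by
      intro s
      induction s with
      | zero =>
        intro i hi k hk
        have h4 := hrow k
        rw [Finset.sum_eq_single k] at h4
        · simpa [xx, UU, h2] using h4
        · intro l _ hl
          have : ¬ ((k : ℕ) ≤ l) := by
            have := l.2
            intro h
            apply hl
            apply Fin.ext
            omega
          rw [xx, if_neg this, h3, zero_mul]
        · simp
      | succ s ih =>
        intro i hi k hk
        have ih := ih (i + 1) (by omega)
        rcases Nat.lt_or_ge i k with h | h
        · exact ih k h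
        have h4 := hrow k
        rw [Finset.sum_eq_single k] at h4
        · simpa [xx, UU, h2] using h4
        · intro l _ hl
          by_cases hkl : (k : ℕ) ≤ l
          · have : (k : ℕ) ≠ l := fun h => hl (Fin.ext h.symm)
            rw [ih l (by omega), mul_zero]
          · rw [xx, if_neg hkl, h3, zero_mul]
        · simp
    have hw0 : w = 0 := by
      funext k
      exact hw m 0 (by omega) k (by omega)
    have := Fintype.linearIndependent_iff.1 hbli v hw0
    funext j
    exact this j
  have hker : ∀ᵐ t ∂mu, ∀ v : Fin d → ℂ, (∀ i, i < m → ∑ j, y i j t * v j = 0) → v = 0 := by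
    filter_upwards [hck, huni] with t h1 h2 v hv
    exact h2 v (h1 v hv)
  -- the shifted chains
  choose S hS0 hS1 hS2 using fun x => hX.shift x 1
  have hTS : ∀ i, i < m → ∀ x, T i (S x) = S (T i x) + X 0 (T i (S x)) • E 0 := by
    intro i hi x
    refine hX.ext fun n => ?_
    rw [map_add, map_smul, hE]
    cases n with
    | zero => rw [hS0 _ 0 (by omega)]; simp
    | succ n =>
      rw [hS1, if_neg (by omega), smul_zero, add_zero]
      refine HasSum.unique (hT i hi (S x) (n + 1)) ?_
      rw [← (add_left_injective 1).hasSum_iff]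
      · convert hT i hi x n using 1
        funext k
        simp only [Function.comp]
        rw [hS1]
        congr 2; push_cast; ring
      · intro k hk
        have : k < 1 := by
          by_contra h
          exact hk ⟨k - 1, by simp; omega⟩
        rw [hS0 _ k this, mul_zero]
  have hzero : S 0 = 0 := hX.ext fun n => by
    rw [map_zero]
    cases n with
    | zero => exact hS0 _ 0 (by omega)
    | succ n => rw [hS1, map_zero]
  have hcoef : ∀ N : ℕ, ∃ c : Fin d → TT → ℂ, (∀ t, ∑ j, b j (Fin.last m) * c j t = 1) ∧
      ∀ i, i ≤ m → ∀ᵐ t ∂mu,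
        fourier (-(N : ℤ)) t * F (P i (E N)) t = ∑ j, z i j t * c j t := by
    intro N
    induction N with
    | zero =>
      have hx := ch_unique T (E 0) m (Pi.single (Fin.last m) 1) (fun i => P i (E 0))
        (by simp [hPm]) (fun i hi => by
          rw [Pi.single_eq_of_ne (by intro h; have := congrArg Fin.val h; simp at this; omega)]
          simp [hP i hi])
      obtain ⟨a, ha⟩ := hbsp (Pi.single (Fin.last m) 1) (by rw [← hx 0 (by omega), hP0]; rfl)
      refine ⟨fun j _ => a j, fun t => ?_, fun i hi => ?_⟩
      · have := congrFun ha (Fin.last m)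
        rw [Pi.single_eq_same] at this
        rw [this, Finset.sum_apply]
        refine Finset.sum_congr rfl fun j _ => ?_
        rw [Pi.smul_apply, smul_eq_mul, mul_comm]
      · have h1 := hx i hi
        rw [ha, ch_lin] at h1
        have h2 : Rep X (P i (E 0)) (fun t => ∑ j, a j * z i j t) := by
          rw [h1]
          exact Rep.sum (X := X) Finset.univ a (fun j => hF _)
        filter_upwards [(hF _).ae_eq h2] with t ht
        rw [ht]
        simp only [Nat.cast_zero, neg_zero, fourier_zero, one_mul]
        exact Finset.sum_congr rfl fun j _ => mul_comm _ _
    | succ N ih =>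
      obtain ⟨c', hc1, hc2⟩ := ih
      let w : Fin (m + 1) → ℂ := fun k =>
        if (k : ℕ) < m then X 0 (T k (S (P (k + 1) (E N)))) else 0
      have hx := ch_unique T (E 0) m w (fun i => P i (E (N + 1)) - S (P i (E N)))
        (by
          have : S (E N) = E (N + 1) := hX.ext fun n => by
            rw [hE]
            cases n with
            | zero => rw [hS0 _ 0 (by omega)]; simp
            | succ n => rw [hS1, hE]; simp
          simp [hPm, w, this]) (fun i hi => by
          have h1 := hTS i hi (P (i + 1) (E N))
          simp only [w, hi, if_true]
          rw [hP i hi, mul_apply_eq_comp, mul_apply_eq_comp, map_sub]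
          generalize X 0 (T i (S (P (i + 1) (E N)))) = q at *
          rw [h1]
          abel)
      obtain ⟨a, ha⟩ := hbsp w (by rw [← hx 0 (by omega), hP0]; simp [hzero])
      refine ⟨fun j t => c' j t + a j * fourier (-((N + 1 : ℕ) : ℤ)) t, fun t => ?_,
        fun i hi => ?_⟩
      · have h1 : ∑ j, b j (Fin.last m) * a j = 0 := by
          have := congrFun ha (Fin.last m)
          have hw : w (Fin.last m) = 0 := by simp [w]
          rw [hw, Finset.sum_apply] at this
          rw [this]
          refine Finset.sum_congr rfl fun j _ => ?_
          rw [Pi.smul_apply, smul_eq_mul, mul_comm]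
        simp only [mul_add, Finset.sum_add_distrib, ← mul_assoc, ← Finset.sum_mul]
        rw [hc1, h1, zero_mul, add_zero]
      · have h1 := hx i hi
        rw [ha, ch_lin] at h1
        simp only [sub_eq_iff_eq_add] at h1
        have h2 : Rep X (P i (E (N + 1))) ((fun t => ∑ j, a j * z i j t) +
            fun t => fourier 1 t * F (P i (E N)) t) := by
          rw [h1]
          exact (Rep.sum (X := X) Finset.univ a (fun j => hF _)).add
            ((hF _).shift (hS0 _ 0 (by omega)) (hS1 _))
        filter_upwards [(hF _).ae_eq h2, hc2 i hi] with t ht ht2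
        rw [ht, Pi.add_apply, mul_add, ← mul_assoc, ← fourier_add,
          show -((N + 1 : ℕ) : ℤ) + 1 = -(N : ℤ) by push_cast; ring, ht2, Finset.mul_sum,
          ← Finset.sum_add_distrib]
        refine Finset.sum_congr rfl fun j _ => ?_
        ring
  refine contra (m := m) y hy hker (fun j => b j (Fin.last m)) fun N => ?_
  obtain ⟨c', hc1, hc2⟩ := hcoef (N + 1)
  refine ⟨c', hc1, fun i hi => ?_⟩
  have hd := hstep i hi (P i (E (N + 1))) (P (i + 1) (E (N + 1))) 0 (fun n _ => by
    rw [hP i hi]; rfl)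
  refine ⟨fun t => fourier (-((N + 1 : ℕ) : ℤ)) t *
    (F (P i (E (N + 1))) t - φ i t * F (P (i + 1) (E (N + 1))) t),
    memLp_fourier_mul _ hd.1, fun n hn => ?_, ?_⟩
  · rw [cf_fourier_mul]
    apply hd.2
    push_cast; omega
  · filter_upwards [hc2 i hi.le, hc2 (i + 1) hi] with t h1 h2
    rw [mul_sub, mul_left_comm, h1, h2, Finset.mul_sum, ← Finset.sum_sub_distrib]
    refine Finset.sum_congr rfl fun j _ => ?_
    simp only [y]; ring

end Main

/-- coordinates -/
noncomputable def XX {H : Type*} [NormedAddCommGroup H] [InnerProductSpace ℂ H] (e : ℕ → H) (n : ℕ) :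
    H →L[ℂ] ℂ := ((n : ℂ) + 1)⁻¹ • innerSL ℂ (e (n + 1))

lemma XX_apply {H : Type*} [NormedAddCommGroup H] [InnerProductSpace ℂ H] (e : ℕ → H) (n : ℕ)
    (x : H) : XX e n x = ((n : ℂ) + 1)⁻¹ * inner ℂ (e (n + 1)) x := rfl

lemma coord_of {H : Type*} [NormedAddCommGroup H] [InnerProductSpace ℂ H] [CompleteSpace H]
    (e : ℕ → H)
    (horth : ∀ m n : ℕ, 1 ≤ m → 1 ≤ n → inner ℂ (e m) (e n) = if m = n then (m : ℂ) else 0)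
    (hdense : Dense (Submodule.span ℂ (e '' {n : ℕ | 1 ≤ n}) : Set H)) :
    Coord (XX e) ∧ ∀ x, HasSum (fun n : ℕ => XX e n x • e (n + 1)) x := by
  let r : ℕ → ℝ := fun n => Real.sqrt ((n : ℝ) + 1)
  have hr2 : ∀ n, r n * r n = (n : ℝ) + 1 := fun n => Real.mul_self_sqrt (by positivity)
  have hrc : ∀ n, (r n : ℂ) * (r n : ℂ) = (n : ℂ) + 1 := fun n => by
    have := congrArg (fun t : ℝ => (t : ℂ)) (hr2 n)
    push_cast at this; exact this
  have hrpos : ∀ n, 0 < r n := fun n => Real.sqrt_pos.2 (by positivity)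
  have hr0 : ∀ n, (r n : ℂ) ≠ 0 := fun n => by exact_mod_cast (hrpos n).ne'
  let v : ℕ → H := fun n => ((r n : ℂ))⁻¹ • e (n + 1)
  have hve : ∀ n, e (n + 1) = (r n : ℂ) • v n := fun n => by
    simp only [v]; rw [smul_smul, mul_inv_cancel₀ (hr0 n), one_smul]
  have hv : Orthonormal ℂ v := by
    rw [orthonormal_iff_ite]
    intro i j
    simp only [v]
    rw [inner_smul_left, inner_smul_right, horth _ _ (by omega) (by omega), map_inv₀,
      Complex.conj_ofReal]
    by_cases h : i = j
    · subst h
      simp only [if_true]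
      push_cast
      rw [← hrc]
      have := hr0 i
      field_simp
    · rw [if_neg (by omega), if_neg h]; simp
  have hsp : ⊤ ≤ (Submodule.span ℂ (Set.range v)).topologicalClosure := by
    have h1 : Submodule.span ℂ (e '' {n : ℕ | 1 ≤ n}) ≤ Submodule.span ℂ (Set.range v) := by
      rw [Submodule.span_le]
      rintro _ ⟨n, hn, rfl⟩
      obtain ⟨k, rfl⟩ : ∃ k, n = k + 1 := ⟨n - 1, by have : 1 ≤ n := hn; omega⟩
      rw [hve]
      exact Submodule.smul_mem _ _ (Submodule.subset_span ⟨k, rfl⟩)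
    have h2 : Dense (Submodule.span ℂ (Set.range v) : Set H) := hdense.mono h1
    rw [(Submodule.dense_iff_topologicalClosure_eq_top).1 h2]
  let B := HilbertBasis.mk hv hsp
  have hB : ∀ n, B n = v n := fun n => by simp [B]
  have hBr : ∀ x n, B.repr x n = (r n : ℂ) * XX e n x := by
    intro x n
    have hin : inner ℂ (e (n + 1)) x = (r n : ℂ) * inner ℂ (v n) x := by
      rw [hve, inner_smul_left, Complex.conj_ofReal]
    rw [HilbertBasis.repr_apply_apply, hB, XX_apply, hin, ← hrc]
    have := hr0 n
    field_simp
  have hnorm : ∀ (n : ℕ) (a : ℂ), ‖(r n : ℂ) * a‖ ^ 2 = ((n : ℝ) + 1) * ‖a‖ ^ 2 := by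
    intro n a
    rw [norm_mul, Complex.norm_real, Real.norm_of_nonneg (hrpos n).le, mul_pow, sq, hr2]
  refine ⟨⟨fun x => ?_, fun a ha => ?_⟩, fun x => ?_⟩
  · have h := lp.hasSum_norm (p := 2) (by norm_num) (B.repr x)
    rw [B.repr.norm_map] at h
    simp only [ENNReal.toReal_ofNat, Real.rpow_ofNat] at h
    simp only [hBr, hnorm] at h
    exact h
  · have hm : Memℓp (fun n => (r n : ℂ) * a n) 2 := by
      apply memℓp_gen
      simpa only [ENNReal.toReal_ofNat, Real.rpow_ofNat, hnorm] using ha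
    refine ⟨B.repr.symm ⟨_, hm⟩, fun n => ?_⟩
    have h := hBr (B.repr.symm ⟨_, hm⟩) n
    rw [LinearIsometryEquiv.apply_symm_apply] at h
    exact (mul_left_cancel₀ (hr0 n) h).symm
  · have h := B.hasSum_repr x
    convert h using 1
    funext n
    rw [hBr, hB, hve, smul_smul, mul_comm]

lemma toep_of {H : Type*} [NormedAddCommGroup H] [InnerProductSpace ℂ H]
    (e : ℕ → H) (hsum : ∀ x, HasSum (fun n : ℕ => XX e n x • e (n + 1)) x) (T : H →L[ℂ] H)
    (c : ℤ → ℂ) (hT : ∀ (p q : ℕ), 1 ≤ p → 1 ≤ q →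
      inner ℂ (e p) (T (e q)) = (p : ℂ) * c ((p : ℤ) - q)) : IsToep (XX e) T c := by
  intro x k
  have h : HasSum _ (XX e k (T x)) := ((XX e k).comp T).hasSum (hsum x)
  convert h using 1
  funext n
  simp only [ContinuousLinearMap.comp_apply, map_smul, smul_eq_mul]
  rw [XX_apply e k, hT _ _ (by omega) (by omega)]
  have h1 : (k : ℂ) + 1 ≠ 0 := by exact_mod_cast Nat.succ_ne_zero k
  push_cast
  rw [show (k : ℤ) + 1 - ((n : ℤ) + 1) = k - n by ring]
  field_simp

end ZP

theorem statement19 {H : Type*} [NormedAddCommGroup H] [InnerProductSpace ℂ H]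
    [CompleteSpace H]
    (e : ℕ → H)
    (horth : ∀ m n : ℕ, 1 ≤ m → 1 ≤ n → ⟪e m, e n⟫ = if m = n then (m : ℂ) else 0)
    (hdense : Dense (Submodule.span ℂ (e '' {n : ℕ | 1 ≤ n}) : Set H))
    (m : ℕ) (hm : 1 ≤ m)
    (T : Fin m → (H →L[ℂ] H)) (cs : Fin m → ℤ → ℂ)
    (hT : ∀ (i : Fin m) (p q : ℕ), 1 ≤ p → 1 ≤ q →
      ⟪e p, T i (e q)⟫ = (p : ℂ) * cs i ((p : ℤ) - q)) :
    -- `T₁ ∘ T₂ ∘ ⋯ ∘ T_m = 0` iff some symbol vanishes identically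
    ((List.ofFn T).prod = 0 ↔ ∃ i : Fin m, ∀ k : ℤ, cs i k = 0) ∧
    -- equivalently, iff `Tᵢ = 0` for some `i`
    ((∃ i : Fin m, ∀ k : ℤ, cs i k = 0) ↔ ∃ i : Fin m, T i = 0) := by
  obtain ⟨hX, hsum⟩ := ZP.coord_of e horth hdense
  have htoep : ∀ i, ZP.IsToep (ZP.XX e) (T i) (cs i) := fun i =>
    ZP.toep_of e hsum (T i) (cs i) (hT i)
  have hzero : ∀ i, (∀ k, cs i k = 0) → T i = 0 := by
    intro i hi
    ext x
    refine hX.ext fun n => ?_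
    have h := htoep i x n
    simp only [hi, zero_mul] at h
    rw [h.unique hasSum_zero]; simp
  have hzero2 : ∀ i, T i = 0 → ∀ k, cs i k = 0 := by
    intro i hi k
    have h := hT i (k.toNat + 1) ((-k).toNat + 1) (by omega) (by omega)
    rw [hi] at h
    simp only [zero_apply, inner_zero_right] at h
    have h2 := (mul_eq_zero.1 h.symm).resolve_left (by exact_mod_cast Nat.succ_ne_zero k.toNat)
    rwa [show ((k.toNat + 1 : ℕ) : ℤ) - (((-k).toNat + 1 : ℕ) : ℤ) = k by omega] at h2
  refine ⟨⟨fun hprod => ?_, ?_⟩, ?_⟩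
  · let T' : ℕ → H →L[ℂ] H := fun i => if h : i < m then T ⟨i, h⟩ else 0
    let c' : ℕ → ℤ → ℂ := fun i => if h : i < m then cs ⟨i, h⟩ else 0
    obtain ⟨i, hi, h⟩ := ZP.main hX m T' c' (fun i hi => by
        simp only [T', c', hi, dif_pos]; exact htoep _)
      (fun i => ((List.ofFn T).drop i).prod)
      (by rw [List.drop_eq_nil_of_le (by simp)]; simp)
      (fun i hi => by
        have hl : i < (List.ofFn T).length := by simpa using hi
        rw [List.drop_eq_getElem_cons hl, List.prod_cons]
        simp only [T', hi, dif_pos]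
        congr 1
        simp)
      (by simpa using hprod)
    refine ⟨⟨i, hi⟩, ?_⟩
    simpa only [c', hi, dif_pos] using h
  · rintro ⟨i, hi⟩
    apply List.prod_eq_zero
    rw [List.mem_ofFn]
    exact ⟨i, hzero i hi⟩
  · exact ⟨fun ⟨i, hi⟩ => ⟨i, hzero i hi⟩, fun ⟨i, hi⟩ => ⟨i, hzero2 i hi⟩⟩
end
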